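/- Countable unions of universally unravelable sets are unravelable: if (T, P_i) is universally unravelable for each i ∈ ℕ, then (T, ⋃_i P_i) is unravelable (indeed universally unravelable). -/

import Mathlib

universe u

namespace GS

variable {A B C : Type u}

/-- A tree on `A`: a set of finite sequences closed under prefixes. -/
def IsTree (T : Set (List A)) : Prop := ∀ ⦃x y : List A⦄, x <+: y → y ∈ T → x ∈ T

/-- A tree is pruned if every node has a proper extension in the tree. -/
def IsPruned (T : Set (List A)) : Prop := ∀ x ∈ T, ∃ a : A, x ++ [a] ∈ T

/-- The body of a tree: infinite sequences all of whose finite prefixes lie in the tree. -/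
def body (T : Set (List A)) : Set (ℕ → A) :=
  {a | ∀ n : ℕ, (List.ofFn fun i : Fin n => a i) ∈ T}

/-- The product of the discrete topologies on `ℕ → A`. -/
def seqTop (A : Type u) : TopologicalSpace (ℕ → A) :=
  @Pi.topologicalSpace ℕ (fun _ => A) (fun _ => ⊥)

/-- The subspace topology on the body of a tree. -/
def bodyTop (T : Set (List A)) : TopologicalSpace {a // a ∈ body T} :=
  TopologicalSpace.induced Subtype.val (seqTop A)

/-- A (functional) strategy for player `i` on the tree `T`: to each position of player `i`
(i.e. of length `≡ i (mod 2)`) in `T` it assigns a legal move. -/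
structure Strategy (T : Set (List A)) (i : ℕ) where
  move : List A → A
  legal : ∀ x ∈ T, x.length % 2 = i % 2 → x ++ [move x] ∈ T

/-- A play is consistent with a strategy of player `i` if all moves of player `i` are
given by the strategy. -/
def Consistent {T : Set (List A)} {i : ℕ} (σ : Strategy T i) (a : ℕ → A) : Prop :=
  ∀ n : ℕ, n % 2 = i % 2 → a n = σ.move (List.ofFn fun j : Fin n => a j)

/-- The plays (branches of the tree) consistent with a strategy; this is the body `[σ]`
of the strategy tree of `σ`. -/
def plays {T : Set (List A)} {i : ℕ} (σ : Strategy T i) : Set (ℕ → A) :=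
  {a ∈ body T | Consistent σ a}

/-- A strategy of player `i` is winning in the game `(T, P)` if every play consistent with it
is won by player `i`. -/
def WinningStrategy (T : Set (List A)) (P : Set (ℕ → A)) {i : ℕ} (σ : Strategy T i) : Prop :=
  ∀ a ∈ plays σ, if i % 2 = 0 then a ∈ P else a ∉ P

/-- A game is determined if one of the two players has a winning strategy. -/
def Determined (T : Set (List A)) (P : Set (ℕ → A)) : Prop :=
  (∃ σ : Strategy T 0, WinningStrategy T P σ) ∨ ∃ σ : Strategy T 1, WinningStrategy T P σ

/-- The strategy tree of a functional strategy: all positions reachable while player `i`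
follows `σ`. -/
def stratTree (T : Set (List A)) (i : ℕ) (σ : Strategy T i) : Set (List A) :=
  {x ∈ T | ∀ (y : List A) (a : A), y ++ [a] <+: x → y.length % 2 = i % 2 → a = σ.move y}

/-- A morphism of trees: an isotone, length-preserving map. -/
structure TreeHom (S : Set (List A)) (T : Set (List B)) where
  toFun : List A → List B
  mem : ∀ x ∈ S, toFun x ∈ T
  len : ∀ x ∈ S, (toFun x).length = x.length
  mono : ∀ ⦃x y : List A⦄, x ∈ S → y ∈ S → x <+: y → toFun x <+: toFun y

/-- The identity tree morphism. -/
def TreeHom.id (S : Set (List A)) : TreeHom S S where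
  toFun := _root_.id
  mem _ hx := hx
  len _ _ := rfl
  mono _ _ _ _ h := h

/-- Composition of tree morphisms. -/
def TreeHom.comp {S : Set (List A)} {T : Set (List B)} {U : Set (List C)}
    (g : TreeHom T U) (f : TreeHom S T) : TreeHom S U where
  toFun := g.toFun ∘ f.toFun
  mem x hx := g.mem _ (f.mem x hx)
  len x hx := by simp only [Function.comp_apply, g.len _ (f.mem x hx), f.len x hx]
  mono x y hx hy hxy := g.mono (f.mem x hx) (f.mem y hy) (f.mono hx hy hxy)

/-- The map induced on infinite branches by a length-preserving isotone map of trees. -/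
def bodyMap [Inhabited B] (f : List A → List B) (a : ℕ → A) : ℕ → B :=
  fun n => (f (List.ofFn fun i : Fin (n + 1) => a i)).getD n default

/-- A covering of trees: a tree morphism `π` together with a map `φ` of strategies (of either
player) satisfying the locality condition and the branch lifting condition. -/
structure Covering [Inhabited A] (S : Set (List B)) (T : Set (List A)) where
  π : TreeHom S T
  φ : ∀ i : ℕ, Strategy S i → Strategy T i
  agree : ∀ (i n : ℕ) (σ σ' : Strategy S i),
    (∀ x ∈ S, x.length ≤ n → σ.move x = σ'.move x) →
    ∀ x ∈ T, x.length ≤ n → (φ i σ).move x = (φ i σ').move x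
  lift : ∀ (i : ℕ) (σ : Strategy S i), ∀ a ∈ plays (φ i σ),
    ∃ a' ∈ plays σ, bodyMap π.toFun a' = a

/-- A covering is `k`-fixing if `π` restricts to a bijection on the first `k` levels and `φ` is
induced by `π` there. -/
structure IsFixing [Inhabited A] {S : Set (List B)} {T : Set (List A)} (k : ℕ)
    (c : Covering S T) : Prop where
  bij : Function.Bijective fun x : {x : List B // x ∈ S ∧ x.length ≤ k} =>
    (⟨c.π.toFun x.1, c.π.mem _ x.2.1, by rw [c.π.len _ x.2.1]; exact x.2.2⟩ :
      {x : List A // x ∈ T ∧ x.length ≤ k})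
  induced : ∀ (i : ℕ) (σ : Strategy S i), ∀ x ∈ S, x.length < k → x.length % 2 = i % 2 →
    c.π.toFun (x ++ [σ.move x]) = c.π.toFun x ++ [(c.φ i σ).move (c.π.toFun x)]

/-- A game `(T, P)` is unravelable if for every `k` there is a `k`-fixing covering of `T` such
that the preimage of `P` is clopen in the body of the covering tree. -/
def Unravelable [Inhabited A] (T : Set (List A)) (P : Set (ℕ → A)) : Prop :=
  ∀ k : ℕ, ∃ (B : Type u) (S : Set (List B)) (c : Covering S T),
    IsTree S ∧ IsPruned S ∧ S.Nonempty ∧ IsFixing k c ∧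
    @IsClopen _ (bodyTop S) {a : {a // a ∈ body S} | bodyMap c.π.toFun a.1 ∈ P}

/-- A game `(T, P)` is universally unravelable if for every covering of `T` the game with the
preimage of `P` as payoff set is unravelable. -/
def UnivUnravelable [Inhabited A] (T : Set (List A)) (P : Set (ℕ → A)) : Prop :=
  ∀ (B : Type u) (_ : Inhabited B) (S : Set (List B)) (c : Covering S T),
    IsTree S → IsPruned S → S.Nonempty →
    Unravelable S (bodyMap c.π.toFun ⁻¹' P)

end GS

namespace GS

open Classical in
/-- A set of positions together with a candidate move function gives a strategy by replacing
illegal candidates; off the player's turn the move is a default value. -/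
noncomputable def mkStrategy {A : Type u} [Inhabited A] (T : Set (List A)) (hpr : IsPruned T)
    (i : ℕ) (cand : List A → A) : Strategy T i where
  move x :=
    if x.length % 2 = i % 2 then
      if x ++ [cand x] ∈ T then cand x
      else if h : ∃ a, x ++ [a] ∈ T then h.choose else default
    else default
  legal x hx hi := by
    rw [if_pos hi]
    split_ifs with h1 h2
    · exact h1
    · exact h2.choose_spec
    · exact absurd (hpr x hx) h2

section Basic

variable {A B C : Type u}

theorem mkStrategy_move_of_mem [Inhabited A] {T : Set (List A)} (hpr : IsPruned T) {i : ℕ}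
    {cand : List A → A} {x : List A} (hi : x.length % 2 = i % 2) (h : x ++ [cand x] ∈ T) :
    (mkStrategy T hpr i cand).move x = cand x := by
  simp [mkStrategy, hi, h]

theorem mkStrategy_move_congr [Inhabited A] {T : Set (List A)} (hpr : IsPruned T) {i : ℕ}
    {f g : List A → A} {x : List A} (h : x.length % 2 = i % 2 → f x = g x) :
    (mkStrategy T hpr i f).move x = (mkStrategy T hpr i g).move x := by
  by_cases hi : x.length % 2 = i % 2
  · simp only [mkStrategy]
    rw [h hi]
  · simp [mkStrategy, hi]

/-- The initial segment of length `n` of an infinite sequence. -/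
def res (a : ℕ → A) (n : ℕ) : List A := List.ofFn fun i : Fin n => a i

@[simp] theorem length_res (a : ℕ → A) (n : ℕ) : (res a n).length = n := by simp [res]

@[simp] theorem getElem_res (a : ℕ → A) (n i : ℕ) (h : i < (res a n).length) :
    (res a n)[i] = a i := by simp [res]

theorem res_succ (a : ℕ → A) (n : ℕ) : res a (n + 1) = res a n ++ [a n] := by
  rw [res, List.ofFn_succ_last]
  rfl

theorem take_res (a : ℕ → A) {n m : ℕ} (h : n ≤ m) : (res a m).take n = res a n := by
  apply List.ext_getElem
  · simp [h]
  · intro i h1 h2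
    simp

theorem res_prefix (a : ℕ → A) {n m : ℕ} (h : n ≤ m) : res a n <+: res a m := by
  rw [← take_res a h]
  exact List.take_prefix _ _

theorem map_res (f : A → B) (a : ℕ → A) (n : ℕ) :
    (res a n).map f = res (fun m => f (a m)) n := by
  simp [res, List.map_ofFn, Function.comp_def]

theorem eq_res_of_prefix {a : ℕ → A} {n : ℕ} {x : List A} (h : x <+: res a n) :
    x = res a x.length := by
  have h1 := h.length_le
  rw [length_res] at h1
  rw [← take_res a h1]
  exact List.prefix_iff_eq_take.1 h

theorem take_eq_of_prefix {x y : List A} (h : x <+: y) {n : ℕ} (hn : n ≤ x.length) :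
    x.take n = y.take n := by
  obtain ⟨t, rfl⟩ := h
  rw [List.take_append_of_le_length hn]

theorem res_mem {T : Set (List A)} {a : ℕ → A} (h : a ∈ body T) (n : ℕ) : res a n ∈ T := h n

theorem TreeHom.map_res [Inhabited B] {S : Set (List A)} {T : Set (List B)} (f : TreeHom S T)
    {a : ℕ → A} (ha : a ∈ body S) (n : ℕ) : f.toFun (res a n) = res (bodyMap f.toFun a) n := by
  apply List.ext_getElem
  · simp [f.len _ (res_mem ha n)]
  · intro i h1 h2
    have hi : i < n := by simpa using h2
    have hp := f.mono (res_mem ha (i + 1)) (res_mem ha n) (res_prefix a hi)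
    have hl : i < (f.toFun (res a (i + 1))).length := by
      simp [f.len _ (res_mem ha (i + 1))]
    rw [getElem_res, ← hp.getElem hl]
    exact (List.getD_eq_getElem _ _ hl).symm

theorem TreeHom.bodyMap_mem [Inhabited B] {S : Set (List A)} {T : Set (List B)}
    (f : TreeHom S T) {a : ℕ → A} (ha : a ∈ body S) : bodyMap f.toFun a ∈ body T := fun n => by
  change res _ n ∈ T
  rw [← f.map_res ha]
  exact f.mem _ (res_mem ha n)

theorem eq_of_res_eq {a b : ℕ → A} (h : ∀ n, res a n = res b n) : a = b := by
  funext n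
  have := h (n + 1)
  rw [res_succ, res_succ] at this
  simpa using (List.append_inj' this rfl).2

theorem TreeHom.bodyMap_comp [Inhabited B] [Inhabited C] {S : Set (List A)} {T : Set (List B)}
    {U : Set (List C)} (g : TreeHom T U) (f : TreeHom S T) {a : ℕ → A} (ha : a ∈ body S) :
    bodyMap (g.comp f).toFun a = bodyMap g.toFun (bodyMap f.toFun a) := by
  apply eq_of_res_eq
  intro n
  rw [← (g.comp f).map_res ha, ← g.map_res (f.bodyMap_mem ha), ← f.map_res ha]
  rfl

theorem bodyMap_map [Inhabited B] (f : A → B) (a : ℕ → A) :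
    bodyMap (List.map f) a = fun n => f (a n) := by
  funext n
  change ((res a (n + 1)).map f).getD n default = _
  rw [List.getD_eq_getElem _ _ (by simp)]
  simp

/-- Composition of coverings. -/
def Covering.comp [Inhabited A] [Inhabited B] {S : Set (List C)} {T : Set (List B)}
    {U : Set (List A)} (c : Covering T U) (d : Covering S T) : Covering S U where
  π := c.π.comp d.π
  φ i σ := c.φ i (d.φ i σ)
  agree i n σ σ' h := c.agree i n _ _ (d.agree i n σ σ' h)
  lift i σ a ha := by
    obtain ⟨b, hb, rfl⟩ := c.lift i _ a ha
    obtain ⟨e, he, rfl⟩ := d.lift i _ b hb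
    exact ⟨e, he, c.π.bodyMap_comp d.π he.1⟩

theorem TreeHom.bodyMap_id [Inhabited A] (T : Set (List A)) {a : ℕ → A} (ha : a ∈ body T) :
    bodyMap (TreeHom.id T).toFun a = a :=
  eq_of_res_eq fun n => ((TreeHom.id T).map_res ha n).symm

/-- The identity covering. -/
def Covering.id [Inhabited A] (T : Set (List A)) : Covering T T where
  π := TreeHom.id T
  φ _ σ := σ
  agree _ _ _ _ h := h
  lift _ _ a ha := ⟨a, ha, TreeHom.bodyMap_id T ha.1⟩

theorem IsFixing.injOn [Inhabited A] {S : Set (List B)} {T : Set (List A)} {k : ℕ}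
    {c : Covering S T} (h : IsFixing k c) {x y : List B} (hx : x ∈ S) (hy : y ∈ S)
    (hk : x.length ≤ k) (he : c.π.toFun x = c.π.toFun y) : x = y := by
  have hl : y.length = x.length := by rw [← c.π.len _ hx, he, c.π.len _ hy]
  exact congrArg Subtype.val (@h.bij.1 ⟨x, hx, hk⟩ ⟨y, hy, hl ▸ hk⟩ (Subtype.ext he))

theorem IsFixing.exists_eq [Inhabited A] {S : Set (List B)} {T : Set (List A)} {k : ℕ}
    {c : Covering S T} (h : IsFixing k c) {y : List A} (hy : y ∈ T) (hk : y.length ≤ k) :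
    ∃ x ∈ S, c.π.toFun x = y := by
  obtain ⟨⟨x, hx, _⟩, hx2⟩ := h.bij.2 ⟨y, hy, hk⟩
  exact ⟨x, hx, congrArg Subtype.val hx2⟩

theorem IsFixing.intro [Inhabited A] {S : Set (List B)} {T : Set (List A)} {k : ℕ}
    {c : Covering S T}
    (inj : ∀ x ∈ S, ∀ y ∈ S, x.length ≤ k → c.π.toFun x = c.π.toFun y → x = y)
    (surj : ∀ y ∈ T, y.length ≤ k → ∃ x ∈ S, c.π.toFun x = y)
    (ind : ∀ (i : ℕ) (σ : Strategy S i), ∀ x ∈ S, x.length < k → x.length % 2 = i % 2 →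
      c.π.toFun (x ++ [σ.move x]) = c.π.toFun x ++ [(c.φ i σ).move (c.π.toFun x)]) :
    IsFixing k c := by
  refine ⟨⟨?_, ?_⟩, ind⟩
  · rintro ⟨x, hx, hk⟩ ⟨y, hy, _⟩ h
    exact Subtype.ext (inj x hx y hy hk (congrArg Subtype.val h))
  · rintro ⟨y, hy, hk⟩
    obtain ⟨x, hx, rfl⟩ := surj y hy hk
    exact ⟨⟨x, hx, by rwa [c.π.len _ hx] at hk⟩, rfl⟩

theorem IsFixing.mono [Inhabited A] {S : Set (List B)} {T : Set (List A)} {k l : ℕ}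
    {c : Covering S T} (h : IsFixing k c) (hl : l ≤ k) : IsFixing l c :=
  .intro (fun _ hx _ hy hk => h.injOn hx hy (hk.trans hl))
    (fun _ hy hk => h.exists_eq hy (hk.trans hl))
    (fun i σ x hx hk => h.induced i σ x hx (hk.trans_le hl))

theorem IsFixing.id [Inhabited A] (T : Set (List A)) (k : ℕ) : IsFixing k (Covering.id T) :=
  .intro (fun _ _ _ _ _ h => h) (fun y hy _ => ⟨y, hy, rfl⟩) (fun _ _ _ _ _ _ => rfl)

theorem IsFixing.comp [Inhabited A] [Inhabited B] {S : Set (List C)} {T : Set (List B)}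
    {U : Set (List A)} {k : ℕ} {c : Covering T U} {d : Covering S T} (hc : IsFixing k c)
    (hd : IsFixing k d) : IsFixing k (c.comp d) := by
  refine .intro (fun x hx y hy hk h => ?_) (fun y hy hk => ?_) (fun i σ x hx hk hi => ?_)
  · exact hd.injOn hx hy hk (hc.injOn (d.π.mem _ hx) (d.π.mem _ hy)
      (by rwa [d.π.len _ hx]) h)
  · obtain ⟨z, hz, rfl⟩ := hc.exists_eq hy hk
    obtain ⟨x, hx, rfl⟩ := hd.exists_eq hz (by rwa [c.π.len _ hz] at hk)
    exact ⟨x, hx, rfl⟩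
  · change c.π.toFun (d.π.toFun _) = c.π.toFun (d.π.toFun _) ++ [(c.φ i (d.φ i σ)).move _]
    rw [hd.induced i σ x hx hk hi]
    exact hc.induced i _ _ (d.π.mem _ hx) (by rwa [d.π.len _ hx]) (by rwa [d.π.len _ hx])

theorem Unravelable.congr [Inhabited A] {T : Set (List A)} {P Q : Set (ℕ → A)}
    (h : Unravelable T P) (hPQ : ∀ a ∈ body T, a ∈ P ↔ a ∈ Q) : Unravelable T Q := by
  intro k
  obtain ⟨B, S, c, h1, h2, h3, h4, h5⟩ := h k
  refine ⟨B, S, c, h1, h2, h3, h4, ?_⟩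
  convert h5 using 2
  ext a
  exact (hPQ _ (c.π.bodyMap_mem a.2)).symm

/-- Membership of a sequence in an open subset of the body is decided by a finite initial
segment. -/
theorem exists_res_of_isOpen {T : Set (List A)} {D : Set {a // a ∈ body T}}
    (hD : @IsOpen _ (bodyTop T) D) {a : {a // a ∈ body T}} (ha : a ∈ D) :
    ∃ n, ∀ b : {b // b ∈ body T}, res b.1 n = res a.1 n → b ∈ D := by
  let : TopologicalSpace A := ⊥
  obtain ⟨U, hU, rfl⟩ := hD
  obtain ⟨I, u, hu, hs⟩ := isOpen_pi_iff.1 hU a.1 ha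
  refine ⟨I.sup _root_.id + 1, fun b hb => hs fun i hi => ?_⟩
  have hlt : i < I.sup _root_.id + 1 := Nat.lt_succ_of_le (Finset.le_sup (f := _root_.id) hi)
  have : b.1 i = a.1 i := by
    have h1 := getElem_res b.1 (I.sup _root_.id + 1) i (by simpa using hlt)
    have h2 := getElem_res a.1 (I.sup _root_.id + 1) i (by simpa using hlt)
    rw [← h1, ← h2]
    simp only [hb]
  rw [this]
  exact (hu i hi).2

theorem isOpen_of_res {T : Set (List A)} {D : Set {a // a ∈ body T}}
    (h : ∀ a ∈ D, ∃ n, ∀ b : {b // b ∈ body T}, res b.1 n = res a.1 n → b ∈ D) :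
    @IsOpen _ (bodyTop T) D := by
  let : TopologicalSpace A := ⊥
  have : DiscreteTopology A := ⟨rfl⟩
  let := bodyTop T
  refine isOpen_iff_forall_mem_open.2 fun a ha => ?_
  obtain ⟨n, hn⟩ := h a ha
  refine ⟨Subtype.val ⁻¹' {b : ℕ → A | ∀ i ∈ Set.Iio n, b i = a.1 i}, fun b hb => hn b ?_, ?_,
    fun _ _ => rfl⟩
  · apply List.ext_getElem
    · simp
    · intro i h1 h2
      simpa using hb i (by simpa using h1)
  · refine ⟨_, ?_, rfl⟩
    exact isOpen_set_pi (s := fun i => {a.1 i}) (Set.finite_Iio n) fun _ _ => isOpen_discrete _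

theorem isClopen_of_res {T : Set (List A)} {D : Set {a // a ∈ body T}} (n : ℕ)
    (h : ∀ a b : {b // b ∈ body T}, res b.1 n = res a.1 n → a ∈ D → b ∈ D) :
    @IsClopen _ (bodyTop T) D := by
  let := bodyTop T
  exact ⟨⟨isOpen_of_res fun a ha => ⟨n, fun b hb hbD => ha (h b a hb.symm hbD)⟩⟩,
    isOpen_of_res fun a ha => ⟨n, fun b hb => h a b hb ha⟩⟩

end Basic

section Limit

theorem exists_thread {X : ℕ → Type*} (r : ∀ n, X (n + 1) → X n → Prop) (n : ℕ)
    (up : ∀ m, n ≤ m → ∀ x, ∃ y, r m y x) (down : ∀ m, m < n → ∀ y, ∃ x, r m y x) (x : X n) :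
    ∃ z : ∀ m, X m, z n = x ∧ ∀ m, r m (z (m + 1)) (z m) := by
  induction n generalizing X with
  | zero =>
    choose f hf using fun m => up m (Nat.zero_le m)
    exact ⟨fun m => Nat.rec x (fun m y => f m y) m, rfl, fun m => hf m _⟩
  | succ n ih =>
    obtain ⟨z, hz, hr⟩ := ih (X := fun m => X (m + 1)) (fun m => r (m + 1))
      (fun m hm => up (m + 1) (by omega)) (fun m hm => down (m + 1) (by omega)) x
    obtain ⟨y, hy⟩ := down 0 (Nat.succ_pos n) (z 0)
    exact ⟨fun m => Nat.casesOn m y z, hz, fun m => by cases m with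
      | zero => exact hy
      | succ m => exact hr m⟩

/-- The inverse limit of a sequence of trees: sequences of compatible positions. -/
def limTree {B : ℕ → Type u} [∀ n, Inhabited (B n)] {S : ∀ n, Set (List (B n))}
    (c : ∀ n, Covering (S (n + 1)) (S n)) : Set (List (∀ n, B n)) :=
  {x | ∀ n, x.map (· n) ∈ S n ∧ (c n).π.toFun (x.map (· (n + 1))) = x.map (· n)}

variable {B : ℕ → Type u} [∀ n, Inhabited (B n)] {S : ∀ n, Set (List (B n))}
  {c : ∀ n, Covering (S (n + 1)) (S n)} {k : ℕ}

theorem isTree_limTree (hS : ∀ n, IsTree (S n)) : IsTree (limTree c) := by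
  intro x y hxy hy n
  have h1 := fun m => hS m (hxy.map (· m)) (hy m).1
  refine ⟨h1 n, ?_⟩
  have h2 := (c n).π.mono (h1 (n + 1)) (hy (n + 1)).1 (hxy.map (· (n + 1)))
  rw [(hy n).2] at h2
  have h3 := hxy.map (· n)
  refine (List.prefix_of_prefix_length_le h2 h3 ?_).eq_of_length ?_ <;>
  simp [(c n).π.len _ (h1 (n + 1))]

theorem limTree_ext (hf : ∀ n, IsFixing (k + n) (c n)) {x y : List (∀ n, B n)}
    (hx : x ∈ limTree c) (hy : y ∈ limTree c) {n : ℕ} (hl : x.length ≤ k + n)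
    (h : x.map (· n) = y.map (· n)) : x = y := by
  have hlen : x.length = y.length := by simpa using congrArg List.length h
  have up : ∀ j, x.map (· (n + j)) = y.map (· (n + j)) := by
    intro j
    induction j with
    | zero => exact h
    | succ j ih =>
      refine (hf (n + j)).injOn (hx (n + j + 1)).1 (hy (n + j + 1)).1 (by simp; omega) ?_
      exact (hx (n + j)).2.trans (ih.trans (hy (n + j)).2.symm)
  have down : ∀ j m, m + j = n → x.map (· m) = y.map (· m) := by
    intro j
    induction j with
    | zero => rintro m rfl; exact h
    | succ j ih =>
      intro m hm
      rw [← (hx m).2, ← (hy m).2, ih (m + 1) (by omega)]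
  have all : ∀ m, x.map (· m) = y.map (· m) := by
    intro m
    obtain hm | hm := le_total m n
    · exact down (n - m) m (by omega)
    · obtain ⟨j, rfl⟩ := Nat.exists_eq_add_of_le hm
      exact up j
  refine List.ext_getElem hlen fun i h1 h2 => funext fun m => ?_
  have := List.getElem_of_eq (all m) (i := i) (by simpa using h1)
  simpa using this

theorem exists_limTree_map_eq (hf : ∀ n, IsFixing (k + n) (c n)) {n : ℕ} {y : List (B n)}
    (hy : y ∈ S n) (hl : y.length ≤ k + n) : ∃ x ∈ limTree c, x.map (· n) = y := by
  obtain ⟨z, hz, hr⟩ := exists_thread (X := fun m => {x // x ∈ S m ∧ x.length = y.length})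
    (fun m u v => (c m).π.toFun u.1 = v.1) n
    (fun m hm u => by
      obtain ⟨v, hv, he⟩ := (hf m).exists_eq u.2.1 (by rw [u.2.2]; omega)
      exact ⟨⟨v, hv, by rw [← (c m).π.len _ hv, he, u.2.2]⟩, he⟩)
    (fun m _ u => ⟨⟨_, (c m).π.mem _ u.2.1, by rw [(c m).π.len _ u.2.1, u.2.2]⟩, rfl⟩)
    ⟨y, hy, rfl⟩
  have hmap : ∀ m, (List.ofFn fun (i : Fin y.length) m =>
      (z m).1[i.1]'(by rw [(z m).2.2]; exact i.2)).map (· m) = (z m).1 := by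
    intro m
    apply List.ext_getElem
    · simp [(z m).2.2]
    · intro i h1 h2
      simp
  refine ⟨_, fun m => ?_, (hmap n).trans (congrArg Subtype.val hz)⟩
  rw [hmap, hmap]
  exact ⟨(z m).2.1, hr m⟩

theorem isPruned_limTree (hS : ∀ n, IsPruned (S n)) (hT : ∀ n, IsTree (S n))
    (hf : ∀ n, IsFixing (k + n) (c n)) : IsPruned (limTree c) := by
  intro x hx
  obtain ⟨b, hb⟩ := hS (x.length + 1) _ (hx (x.length + 1)).1
  obtain ⟨z, hz, he⟩ := exists_limTree_map_eq hf hb (by simp)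
  have hzl : z.length = x.length + 1 := by simpa using congrArg List.length he
  have hx' : z.take x.length = x := by
    refine limTree_ext hf (isTree_limTree hT (List.take_prefix _ _) hz) hx
      (n := x.length + 1) (by simp; omega) ?_
    rw [List.map_take, he, List.take_left' (by simp)]
  refine ⟨z[x.length], ?_⟩
  have : z.take x.length ++ [z[x.length]] = z := by
    rw [List.take_concat_get', List.take_of_length_le hzl.le]
  rw [hx'] at this
  rwa [this]

theorem nil_mem {A : Type u} {T : Set (List A)} (hT : IsTree T) (hne : T.Nonempty) : [] ∈ T :=
  let ⟨_, hx⟩ := hne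
  hT List.nil_prefix hx

theorem nonempty_limTree (hS : ∀ n, IsTree (S n)) (hne : ∀ n, (S n).Nonempty) :
    (limTree c).Nonempty := by
  refine ⟨[], fun n => ⟨nil_mem (hS n) (hne n), List.eq_nil_of_length_eq_zero ?_⟩⟩
  exact (c n).π.len _ (nil_mem (hS (n + 1)) (hne (n + 1)))

theorem limTree_res {a : ∀ n, ℕ → B n} (ha : ∀ n, a n ∈ body (S n))
    (h : ∀ n, bodyMap (c n).π.toFun (a (n + 1)) = a n) :
    (fun m n => a n m) ∈ body (limTree c) := by
  intro l
  change res (fun m n => a n m) l ∈ limTree c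
  intro n
  simp only [map_res]
  refine ⟨res_mem (ha n) l, ?_⟩
  rw [(c n).π.map_res (ha (n + 1)), h]

theorem body_limTree {a : ℕ → ∀ n, B n} (ha : a ∈ body (limTree c)) (n : ℕ) :
    (fun m => a m n) ∈ body (S n) := by
  intro l
  change res (fun m => a m n) l ∈ S n
  rw [← map_res (fun b : ∀ n, B n => b n)]
  exact (res_mem ha l n).1

theorem bodyMap_limTree {a : ℕ → ∀ n, B n} (ha : a ∈ body (limTree c)) (n : ℕ) :
    bodyMap (c n).π.toFun (fun m => a m (n + 1)) = fun m => a m n := by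
  apply eq_of_res_eq
  intro l
  rw [← (c n).π.map_res (body_limTree ha (n + 1)), ← map_res (fun b : ∀ n, B n => b (n + 1)),
    ← map_res (fun b : ∀ n, B n => b n)]
  exact (res_mem ha l n).2

open Classical in
/-- The moves on the `n`-th tree copied from a strategy on the limit tree, on the levels where
the limit tree agrees with the `n`-th tree. -/
noncomputable def limCand (c : ∀ n, Covering (S (n + 1)) (S n)) (k : ℕ) {i : ℕ}
    (σ : Strategy (limTree c) i) (n : ℕ) (y : List (B n)) : B n :=
  if h : y.length < k + n ∧ ∃ x ∈ limTree c, x.map (· n) = y then σ.move h.2.choose n else default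

theorem limCand_map (hf : ∀ n, IsFixing (k + n) (c n)) {i : ℕ} (σ : Strategy (limTree c) i)
    {n : ℕ} {x : List (∀ n, B n)} (hx : x ∈ limTree c) (hl : x.length < k + n) :
    limCand c k σ n (x.map (· n)) = σ.move x n := by
  have h : (x.map (· n)).length < k + n ∧ ∃ z ∈ limTree c, z.map (· n) = x.map (· n) :=
    ⟨by simpa using hl, x, hx, rfl⟩
  rw [limCand, dif_pos h]
  rw [← limTree_ext hf hx h.2.choose_spec.1 hl.le h.2.choose_spec.2.symm]

/-- The strategy on the `n`-th tree obtained by transporting a strategy on the limit tree to the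
`(n + j)`-th tree and then applying the coverings in between. -/
noncomputable def limStep (c : ∀ n, Covering (S (n + 1)) (S n)) (hS : ∀ n, IsPruned (S n)) (k : ℕ)
    {i : ℕ} (σ : Strategy (limTree c) i) : ℕ → ∀ n, Strategy (S n) i
  | 0, n => mkStrategy (S n) (hS n) i (limCand c k σ n)
  | j + 1, n => mkStrategy (S n) (hS n) i ((c n).φ i (limStep c hS k σ j (n + 1))).move

theorem limStep_zero_map (hS : ∀ n, IsPruned (S n)) (hf : ∀ n, IsFixing (k + n) (c n)) {i : ℕ}
    (σ : Strategy (limTree c) i) {n : ℕ} {x : List (∀ n, B n)} (hx : x ∈ limTree c)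
    (hl : x.length < k + n) (hi : x.length % 2 = i % 2) :
    (limStep c hS k σ 0 n).move (x.map (· n)) = σ.move x n := by
  have := limCand_map hf σ hx hl
  rw [limStep, mkStrategy_move_of_mem (hS n) (by simpa using hi), this]
  rw [this]
  simpa using (σ.legal x hx hi n).1

theorem limStep_agree (hS : ∀ n, IsPruned (S n)) {i m : ℕ}
    {σ σ' : Strategy (limTree c) i}
    (h : ∀ x ∈ limTree c, x.length ≤ m → σ.move x = σ'.move x) (j n : ℕ) :
    ∀ y ∈ S n, y.length ≤ m →
      (limStep c hS k σ j n).move y = (limStep c hS k σ' j n).move y := by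
  induction j generalizing n with
  | zero =>
    intro y hy hl
    refine mkStrategy_move_congr (hS n) fun _ => ?_
    unfold limCand
    split_ifs with hc
    · rw [h _ hc.2.choose_spec.1]
      have := congrArg List.length hc.2.choose_spec.2
      rw [List.length_map] at this
      omega
    · rfl
  | succ j ih =>
    intro y hy hl
    refine mkStrategy_move_congr (hS n) fun _ => ?_
    exact (c n).agree i m _ _ (ih (n + 1)) y hy hl

theorem limStep_succ_eq (hS : ∀ n, IsPruned (S n)) (hf : ∀ n, IsFixing (k + n) (c n)) {i : ℕ}
    (σ : Strategy (limTree c) i) (j n : ℕ) :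
    ∀ y ∈ S n, y.length < k + n + j →
      (limStep c hS k σ (j + 1) n).move y = (limStep c hS k σ j n).move y := by
  induction j generalizing n with
  | zero =>
    intro y hy hl
    refine mkStrategy_move_congr (hS n) fun hi => ?_
    obtain ⟨x, hx, rfl⟩ := exists_limTree_map_eq hf hy hl.le
    have hl' : x.length < k + n := by simpa using hl
    have hi' : x.length % 2 = i % 2 := by simpa using hi
    rw [limCand_map hf σ hx hl']
    have h1 := (hf n).induced i (limStep c hS k σ 0 (n + 1)) _ (hx (n + 1)).1
      (by simpa using hl') (by simpa using hi')
    rw [limStep_zero_map hS hf σ hx (by omega) hi', (hx n).2] at h1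
    have h2 := (σ.legal x hx hi' n).2
    simp only [List.map_append, List.map_cons, List.map_nil] at h2
    rw [h2] at h1
    simpa using h1.symm
  | succ j ih =>
    intro y hy hl
    refine mkStrategy_move_congr (hS n) fun _ => ?_
    exact (c n).agree i y.length _ _ (fun x hx hxl => ih (n + 1) x hx (by omega)) y hy le_rfl

theorem limStep_eq (hS : ∀ n, IsPruned (S n)) (hf : ∀ n, IsFixing (k + n) (c n)) {i : ℕ}
    (σ : Strategy (limTree c) i) {j j' n : ℕ} (hj : j ≤ j') {y : List (B n)} (hy : y ∈ S n)
    (hl : y.length < k + n + j) :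
    (limStep c hS k σ j' n).move y = (limStep c hS k σ j n).move y := by
  induction j', hj using Nat.le_induction with
  | base => rfl
  | succ j' hj ih => rw [limStep_succ_eq hS hf σ j' n y hy (by omega), ih]

/-- The strategy on the `n`-th tree induced by a strategy on the limit tree. -/
noncomputable def limStrategy (c : ∀ n, Covering (S (n + 1)) (S n)) (hS : ∀ n, IsPruned (S n))
    (k : ℕ) {i : ℕ} (σ : Strategy (limTree c) i) (n : ℕ) : Strategy (S n) i where
  move y := (limStep c hS k σ (y.length + 1) n).move y
  legal y hy hi := (limStep c hS k σ (y.length + 1) n).legal y hy hi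

theorem limStrategy_move (hS : ∀ n, IsPruned (S n)) {i : ℕ} (σ : Strategy (limTree c) i) {n : ℕ}
    (y : List (B n)) :
    (limStrategy c hS k σ n).move y = (limStep c hS k σ (y.length + 1) n).move y := rfl

theorem limStrategy_map (hS : ∀ n, IsPruned (S n)) (hf : ∀ n, IsFixing (k + n) (c n)) {i : ℕ}
    (σ : Strategy (limTree c) i) {n : ℕ} {x : List (∀ n, B n)} (hx : x ∈ limTree c)
    (hl : x.length < k + n) (hi : x.length % 2 = i % 2) :
    (limStrategy c hS k σ n).move (x.map (· n)) = σ.move x n := by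
  rw [← limStep_zero_map hS hf σ hx hl hi, limStrategy_move]
  exact limStep_eq hS hf σ (Nat.zero_le _) (hx n).1 (by simpa using hl)

theorem limStrategy_eq (hS : ∀ n, IsPruned (S n)) (hf : ∀ n, IsFixing (k + n) (c n)) {i : ℕ}
    (σ : Strategy (limTree c) i) {n : ℕ} {y : List (B n)} (hy : y ∈ S n)
    (hi : y.length % 2 = i % 2) :
    (limStrategy c hS k σ n).move y = ((c n).φ i (limStrategy c hS k σ (n + 1))).move y := by
  have h1 : (limStrategy c hS k σ n).move y =
      (mkStrategy (S n) (hS n) i ((c n).φ i (limStep c hS k σ (y.length + 1) (n + 1))).move).move y :=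
    (limStep_eq hS hf σ (j := y.length + 1) (j' := y.length + 2) (by omega) hy (by omega)).symm
  rw [h1, mkStrategy_move_of_mem (hS n) hi (Strategy.legal _ y hy hi)]
  refine (c n).agree i y.length _ _ (fun x hx hl => ?_) y hy le_rfl
  rw [limStrategy_move]
  exact limStep_eq hS hf σ (by omega) hx (by omega)

/-- The covering of the first tree by the limit tree. -/
noncomputable def limCovering (c : ∀ n, Covering (S (n + 1)) (S n)) (hS : ∀ n, IsPruned (S n))
    (hf : ∀ n, IsFixing (k + n) (c n)) : Covering (limTree c) (S 0) where
  π :=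
    { toFun := List.map (· 0)
      mem := fun x hx => (hx 0).1
      len := fun x _ => by simp
      mono := fun x y _ _ h => h.map _ }
  φ i σ := limStrategy c hS k σ 0
  agree i n σ σ' h y hy hl := by
    rw [limStrategy_move, limStrategy_move]
    exact limStep_agree hS h _ 0 y hy hl
  lift i σ a ha := by
    obtain ⟨z, hz, hr⟩ := exists_thread
      (X := fun n => {a // a ∈ plays (limStrategy c hS k σ n)})
      (fun n u v => bodyMap (c n).π.toFun u.1 = v.1) 0
      (fun n _ u => by
        have hu : u.1 ∈ plays ((c n).φ i (limStrategy c hS k σ (n + 1))) :=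
          ⟨u.2.1, fun m hm => (u.2.2 m hm).trans
            (limStrategy_eq hS hf σ (res_mem u.2.1 m) (by simpa using hm))⟩
        obtain ⟨v, hv, he⟩ := (c n).lift i _ _ hu
        exact ⟨⟨v, hv⟩, he⟩)
      (fun n hn => absurd hn (Nat.not_lt_zero n)) ⟨a, ha⟩
    have hb := limTree_res (c := c) (fun n => (z n).2.1) hr
    refine ⟨_, ⟨hb, fun m hm => ?_⟩, ?_⟩
    · have hmem := res_mem hb m
      have hmem' := res_mem hb (m + 1)
      have h1 := σ.legal _ hmem (by simpa using hm)
      have h2 := limTree_ext hf hmem' h1 (n := m + 1) (by simp) (by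
        rw [res_succ]
        simp only [List.map_append, List.map_cons, List.map_nil]
        rw [← limStrategy_map hS hf σ hmem (by simp; omega) (by simpa using hm), map_res]
        exact congrArg (_ ++ [·]) ((z (m + 1)).2.2 m hm))
      rw [res_succ] at h2
      exact List.singleton_injective (List.append_inj' h2 rfl).2
    · rw [bodyMap_map]
      exact congrArg Subtype.val hz

theorem isFixing_limCovering (hS : ∀ n, IsPruned (S n)) (hf : ∀ n, IsFixing (k + n) (c n)) :
    IsFixing k (limCovering c hS hf) :=
  .intro (fun x hx y hy hk h => limTree_ext hf hx hy (n := 0) hk h)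
    (fun y hy hk => exists_limTree_map_eq (n := 0) hf hy hk)
    (fun i σ x hx hk hi => by
      have := limStrategy_map (n := 0) hS hf σ hx hk hi
      simp only [limCovering, List.map_append, List.map_cons, List.map_nil, this])

end Limit

section Reach

variable {A : Type u}

/-- Positions from which the player moving at parity `j` can force the play in `R` to reach `G`,
stratified by an ordinal rank. -/
inductive ReachRank (R G : Set (List A)) (j : ℕ) : Ordinal.{u} → List A → Prop
  | goal {x : List A} {α : Ordinal.{u}} : x ∈ G → ReachRank R G j α x
  | own {x : List A} {a : A} {α β : Ordinal.{u}} : x.length % 2 = j → x ++ [a] ∈ R → β < α →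
      ReachRank R G j β (x ++ [a]) → ReachRank R G j α x
  | opp {x : List A} {α : Ordinal.{u}} (β : A → Ordinal.{u}) : x.length % 2 ≠ j →
      (∀ a, β a < α) → (∀ a, x ++ [a] ∈ R → ReachRank R G j (β a) (x ++ [a])) →
      ReachRank R G j α x

/-- The positions from which the player moving at parity `j` can force the play to reach `G`. -/
def Reach (R G : Set (List A)) (j : ℕ) : Set (List A) := {x | ∃ α, ReachRank R G j α x}

variable {R G : Set (List A)} {j : ℕ}

theorem subset_reach : G ⊆ Reach R G j := fun _ h => ⟨0, .goal h⟩

theorem not_reach_own {x : List A} (h : x ∉ Reach R G j) (hj : x.length % 2 = j) {a : A}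
    (ha : x ++ [a] ∈ R) : x ++ [a] ∉ Reach R G j := fun ⟨β, hβ⟩ =>
  h ⟨Order.succ β, .own hj ha (Order.lt_succ β) hβ⟩

theorem not_reach_opp {x : List A} (h : x ∉ Reach R G j) (hj : x.length % 2 ≠ j) :
    ∃ a, x ++ [a] ∈ R ∧ x ++ [a] ∉ Reach R G j := by
  by_contra! hc
  refine h ?_
  have : ∀ a, ∃ β : Ordinal.{u}, x ++ [a] ∈ R → ReachRank R G j β (x ++ [a]) := by
    intro a
    by_cases ha : x ++ [a] ∈ R
    · obtain ⟨β, hβ⟩ := hc a ha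
      exact ⟨β, fun _ => hβ⟩
    · exact ⟨0, fun h => absurd h ha⟩
  choose β hβ using this
  refine ⟨Order.succ (⨆ a, β a), .opp β hj (fun a => ?_) hβ⟩
  exact Order.lt_succ_of_le (Ordinal.le_iSup β a)

/-- The least rank witnessing that a position is in `Reach`. -/
noncomputable def rank (R G : Set (List A)) (j : ℕ) (x : List A) : Ordinal.{u} :=
  sInf {α | ReachRank R G j α x}

theorem reachRank_rank {x : List A} (h : x ∈ Reach R G j) : ReachRank R G j (rank R G j x) x :=
  csInf_mem (s := {α | ReachRank R G j α x}) h

theorem rank_le {x : List A} {α : Ordinal.{u}} (h : ReachRank R G j α x) : rank R G j x ≤ α :=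
  csInf_le' h

open Classical in
/-- A move decreasing the rank. -/
noncomputable def reachMove [Inhabited A] (R G : Set (List A)) (j : ℕ) (x : List A) : A :=
  if h : ∃ a, x ++ [a] ∈ R ∧ x ++ [a] ∈ Reach R G j ∧ rank R G j (x ++ [a]) < rank R G j x then
    h.choose else default

theorem reachMove_spec [Inhabited A] {x : List A} (h : x ∈ Reach R G j) (hG : x ∉ G)
    (hj : x.length % 2 = j) :
    x ++ [reachMove R G j x] ∈ R ∧ x ++ [reachMove R G j x] ∈ Reach R G j ∧
      rank R G j (x ++ [reachMove R G j x]) < rank R G j x := by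
  have : ∃ a, x ++ [a] ∈ R ∧ x ++ [a] ∈ Reach R G j ∧
      rank R G j (x ++ [a]) < rank R G j x := by
    cases reachRank_rank h with
    | goal h => exact absurd h hG
    | own _ ha hβ h => exact ⟨_, ha, ⟨_, h⟩, (rank_le h).trans_lt hβ⟩
    | opp _ hj' => exact absurd hj hj'
  rw [reachMove, dif_pos this]
  exact this.choose_spec

theorem reach_opp {x : List A} (h : x ∈ Reach R G j) (hG : x ∉ G) (hj : x.length % 2 ≠ j) {a : A}
    (ha : x ++ [a] ∈ R) :
    x ++ [a] ∈ Reach R G j ∧ rank R G j (x ++ [a]) < rank R G j x := by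
  cases reachRank_rank h with
  | goal h => exact absurd h hG
  | own hj' => exact absurd hj' hj
  | opp β _ hβ h => exact ⟨⟨_, h a ha⟩, (rank_le (h a ha)).trans_lt (hβ a)⟩

theorem exists_hit [Inhabited A] {a : ℕ → A} {n₀ : ℕ} (h0 : res a n₀ ∈ Reach R G j)
    (hR0 : res a n₀ ∈ R)
    (h : ∀ n, n₀ ≤ n → res a n ∈ R → res a n ∈ Reach R G j →
      (∀ m, n₀ ≤ m → m ≤ n → res a m ∉ G) →
      (n % 2 = j → a n = reachMove R G j (res a n)) ∧ (n % 2 ≠ j → res a (n + 1) ∈ R)) :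
    ∃ n, n₀ ≤ n ∧ res a n ∈ G ∧ res a n ∈ R ∧ ∀ m, n₀ ≤ m → m < n → res a m ∉ G := by
  have step : ∀ n, n₀ ≤ n → res a n ∈ R → res a n ∈ Reach R G j →
      (∀ m, n₀ ≤ m → m ≤ n → res a m ∉ G) →
      res a (n + 1) ∈ R ∧ res a (n + 1) ∈ Reach R G j ∧
        rank R G j (res a (n + 1)) < rank R G j (res a n) := by
    intro n hn h1 h2 h3
    obtain ⟨h4, h5⟩ := h n hn h1 h2 h3
    by_cases hj : n % 2 = j
    · have := reachMove_spec h2 (h3 n hn le_rfl) (by simpa using hj)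
      rwa [← h4 hj, ← res_succ] at this
    · have h6 := h5 hj
      rw [res_succ] at h6 ⊢
      exact ⟨h6, reach_opp h2 (h3 n hn le_rfl) (by simpa using hj) h6⟩
  have inv : ∀ n, n₀ ≤ n → (∀ m, n₀ ≤ m → m < n → res a m ∉ G) →
      res a n ∈ R ∧ res a n ∈ Reach R G j := by
    intro n hn
    induction n, hn using Nat.le_induction with
    | base => exact fun _ => ⟨hR0, h0⟩
    | succ n hn ih =>
      intro hm
      obtain ⟨h1, h2⟩ := ih fun m h1 h2 => hm m h1 (by omega)
      have := step n hn h1 h2 fun m h1 h2 => hm m h1 (by omega)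
      exact ⟨this.1, this.2.1⟩
  have hex : ∃ n, n₀ ≤ n ∧ res a n ∈ G := by
    by_contra! hc
    refine not_strictAnti_of_wellFoundedLT (fun n => rank R G j (res a (n₀ + n))) ?_
    refine strictAnti_nat_of_succ_lt fun n => ?_
    obtain ⟨h1, h2⟩ := inv (n₀ + n) (by omega) fun m hm _ => hc m hm
    exact (step (n₀ + n) (by omega) h1 h2 fun m hm _ => hc m hm).2.2
  classical
  have hmin : ∀ m, n₀ ≤ m → m < Nat.find hex → res a m ∉ G := fun m h1 h2 h3 =>
    Nat.find_min hex h2 ⟨h1, h3⟩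
  exact ⟨_, (Nat.find_spec hex).1, (Nat.find_spec hex).2,
    (inv _ (Nat.find_spec hex).1 hmin).1, hmin⟩

/-- The length of the shortest initial segment of `y` of length at least `l` that lies in `G`. -/
noncomputable def firstHit (G : Set (List A)) (l : ℕ) (y : List A) : ℕ :=
  sInf {n | l ≤ n ∧ n ≤ y.length ∧ y.take n ∈ G}

theorem firstHit_res {a : ℕ → A} {l n m : ℕ} (hl : l ≤ n) (hn : res a n ∈ G)
    (hmin : ∀ m, l ≤ m → m < n → res a m ∉ G) (hm : n ≤ m) : firstHit G l (res a m) = n := by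
  refine le_antisymm (Nat.sInf_le ⟨hl, by simpa using hm, by rwa [take_res a hm]⟩) ?_
  refine le_csInf ⟨n, hl, by simpa using hm, by rwa [take_res a hm]⟩ ?_
  rintro n' ⟨h1, h2, h3⟩
  rw [length_res] at h2
  rw [take_res a h2] at h3
  by_contra! hlt
  exact hmin n' h1 hlt h3

end Reach

section Aux

variable {A : Type u}

/-- A quasi-strategy for the first player in `T` containing the position `p`. -/
def IsQuasi (T Q : Set (List A)) (p : List A) : Prop :=
  p ∈ Q ∧ Q ⊆ T ∧ ∀ x ∈ Q, (x.length % 2 = 1 → ∀ a, x ++ [a] ∈ T → x ++ [a] ∈ Q) ∧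
    (x.length % 2 = 0 → ∃ a, x ++ [a] ∈ Q)

/-- The positions comparable with `u`. -/
def comparable (T : Set (List A)) (u : List A) : Set (List A) := {z ∈ T | z <+: u ∨ u <+: z}

/-- The second player claims that the play will go through a position `u ∈ O`, and from then
on the play follows `u`. -/
def Escape (T O Q V : Set (List A)) (p : List A) : Prop :=
  ∃ u ∈ Q, p <+: u ∧ u ∈ O ∧ V = comparable T u

/-- The second player plays a quasi-strategy inside `Q` which avoids `O`. -/
def Stay (O Q V : Set (List A)) (p : List A) : Prop :=
  p ∈ V ∧ V ⊆ Q ∧ (∀ z ∈ V, z ∉ O) ∧ ∀ z ∈ V,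
    (z.length % 2 = 0 → ∀ a, z ++ [a] ∈ Q → z ++ [a] ∈ V) ∧
    (z.length % 2 = 1 → ∃ a, z ++ [a] ∈ V)

/-- The labels attached to the moves: the moves at levels `K` and `K + 1` are accompanied by sets
of positions. -/
def lab (K : ℕ) (Q V : Set (List A)) (n : ℕ) : Set (List A) :=
  {x | (n = K ∧ x ∈ Q) ∨ (n = K + 1 ∧ x ∈ V)}

/-- The position `y` with its moves labelled. -/
def enc (K : ℕ) (Q V : Set (List A)) (y : List A) : List (A × Set (List A)) :=
  y.mapIdx fun n a => (a, lab K Q V n)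

/-- The positions of the auxiliary game with labels `Q` and `V`. -/
def Pos (T O : Set (List A)) (K : ℕ) (Q V : Set (List A)) (y : List A) : Prop :=
  y ∈ T ∧ (K < y.length → IsQuasi T Q (y.take (K + 1))) ∧
    (K + 1 < y.length → (Escape T O Q V (y.take (K + 2)) ∨ Stay O Q V (y.take (K + 2))) ∧
      ∀ z, z <+: y → K + 1 < z.length → z ∈ V)

/-- The tree of the auxiliary game. -/
def auxTree (T O : Set (List A)) (K : ℕ) : Set (List (A × Set (List A))) :=
  {s | ∃ Q V y, s = enc K Q V y ∧ Pos T O K Q V y}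

variable {T O : Set (List A)} {K : ℕ} {Q V Q' V' : Set (List A)}

@[simp] theorem lab_self : lab K Q V K = Q := by simp [lab]

@[simp] theorem lab_succ : lab K Q V (K + 1) = V := by simp [lab]

theorem lab_of_ne {n : ℕ} (h : n ≠ K) (h' : n ≠ K + 1) : lab K Q V n = ∅ := by simp [lab, h, h']

@[simp] theorem length_enc (y : List A) : (enc K Q V y).length = y.length := by simp [enc]

theorem enc_concat (y : List A) (a : A) :
    enc K Q V (y ++ [a]) = enc K Q V y ++ [(a, lab K Q V y.length)] := by
  simp [enc]

@[simp] theorem map_fst_enc (y : List A) : (enc K Q V y).map Prod.fst = y := by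
  apply List.ext_getElem <;> simp [enc]

theorem enc_congr {y : List A} (h : K < y.length → Q = Q') (h' : K + 1 < y.length → V = V') :
    enc K Q V y = enc K Q' V' y := by
  apply List.ext_getElem
  · simp
  · intro n h1 h2
    have hl : n < y.length := by simpa using h1
    simp only [enc, List.getElem_mapIdx, Prod.mk.injEq, true_and]
    by_cases hn : n = K
    · subst hn; simp [h hl]
    · by_cases hn' : n = K + 1
      · subst hn'; simp [h' hl]
      · rw [lab_of_ne hn hn', lab_of_ne hn hn']

theorem eq_of_enc_eq {y : List A} (h : enc K Q V y = enc K Q' V' y) :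
    (K < y.length → Q = Q') ∧ (K + 1 < y.length → V = V') := by
  constructor
  · intro hl
    have := List.getElem_of_eq h (i := K) (by simpa using hl)
    simpa [enc] using this
  · intro hl
    have := List.getElem_of_eq h (i := K + 1) (by simpa using hl)
    simpa [enc] using this

theorem enc_take (y : List A) (n : ℕ) : enc K Q V (y.take n) = (enc K Q V y).take n := by
  apply List.ext_getElem <;> simp [enc]

theorem enc_res (a : ℕ → A) (n : ℕ) :
    enc K Q V (res a n) = res (fun m => (a m, lab K Q V m)) n := by
  apply List.ext_getElem <;> simp [enc]

theorem Pos.congr {y : List A} (h : Pos T O K Q V y) (hQ : K < y.length → Q = Q')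
    (hV : K + 1 < y.length → V = V') : Pos T O K Q' V' y := by
  refine ⟨h.1, fun hl => hQ hl ▸ h.2.1 hl, fun hl => ?_⟩
  obtain rfl := hQ (by omega)
  obtain rfl := hV hl
  exact h.2.2 hl

theorem enc_mem_auxTree {y : List A} : enc K Q V y ∈ auxTree T O K ↔ Pos T O K Q V y := by
  refine ⟨?_, fun h => ⟨Q, V, y, rfl, h⟩⟩
  rintro ⟨Q', V', y', h, hp⟩
  obtain rfl : y = y' := by simpa using congrArg (List.map Prod.fst) h
  exact hp.congr (fun hl => ((eq_of_enc_eq h).1 hl).symm) fun hl => ((eq_of_enc_eq h).2 hl).symm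

theorem Pos.of_isPrefix (hT : IsTree T) {y z : List A} (h : Pos T O K Q V y) (hz : z <+: y) :
    Pos T O K Q V z := by
  have hl := hz.length_le
  refine ⟨hT hz h.1, fun hk => ?_, fun hk => ⟨?_, fun w hw hwl => ?_⟩⟩
  · rw [take_eq_of_prefix hz hk]
    exact h.2.1 (by omega)
  · rw [take_eq_of_prefix hz hk]
    exact (h.2.2 (by omega)).1
  · exact (h.2.2 (by omega)).2 w (hw.trans hz) hwl

theorem isTree_auxTree (hT : IsTree T) : IsTree (auxTree T O K) := by
  rintro s _ hs ⟨Q, V, y, rfl, hp⟩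
  refine ⟨Q, V, y.take s.length, ?_, hp.of_isPrefix hT (List.take_prefix _ _)⟩
  rw [enc_take]
  exact List.prefix_iff_eq_take.1 hs

/-- What a legal move in the auxiliary game looks like. -/
theorem legal_move {y : List A} {b : A × Set (List A)}
    (h : enc K Q V y ++ [b] ∈ auxTree T O K) :
    y ++ [b.1] ∈ T ∧ (y.length = K → IsQuasi T b.2 (y ++ [b.1])) ∧
      (y.length = K + 1 → Escape T O Q b.2 (y ++ [b.1]) ∨ Stay O Q b.2 (y ++ [b.1])) ∧
      (y.length ≠ K → y.length ≠ K + 1 → b.2 = ∅) ∧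
      (K + 1 < y.length → y ++ [b.1] ∈ V) := by
  obtain ⟨Q', V', z, he, hp⟩ := h
  obtain rfl : y ++ [b.1] = z := by simpa using congrArg (List.map Prod.fst) he
  rw [enc_concat] at he
  obtain ⟨h1, h2⟩ := List.append_inj' he rfl
  obtain ⟨h3, h4⟩ := eq_of_enc_eq h1
  have hb : b.2 = lab K Q' V' y.length := by
    simpa using congrArg Prod.snd (List.singleton_injective h2)
  refine ⟨hp.1, fun hl => ?_, fun hl => ?_, fun hl hl' => ?_, fun hl => ?_⟩
  · rw [hl, lab_self] at hb
    have := hp.2.1 (by simp [hl])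
    rwa [hb, ← List.take_of_length_le (l := y ++ [b.1]) (i := K + 1) (by simp [hl])]
  · rw [hl, lab_succ] at hb
    have := (hp.2.2 (by simp [hl])).1
    rw [List.take_of_length_le (by simp [hl])] at this
    rwa [hb, h3 (by omega)]
  · rw [hb, lab_of_ne hl hl']
  · rw [h4 hl]
    exact (hp.2.2 (by simp; omega)).2 _ (List.prefix_refl _) (by simp; omega)

theorem exists_concat_mem_comparable (hT : IsTree T) (hpr : IsPruned T) {u y : List A}
    (hu : u ∈ T) (hy : y ∈ comparable T u) : ∃ a, y ++ [a] ∈ comparable T u := by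
  obtain ⟨hyT, h | h⟩ := hy
  · obtain ⟨t, rfl⟩ := h
    cases t with
    | nil =>
      obtain ⟨a, ha⟩ := hpr y hyT
      exact ⟨a, ha, .inr (by simp)⟩
    | cons a t =>
      have : y ++ [a] <+: y ++ a :: t := ⟨t, by simp⟩
      exact ⟨a, hT this hu, .inl this⟩
  · obtain ⟨a, ha⟩ := hpr y hyT
    exact ⟨a, ha, .inr (h.trans (List.prefix_append _ _))⟩

theorem isQuasi_self (hpr : IsPruned T) {p : List A} (hp : p ∈ T) : IsQuasi T T p :=
  ⟨hp, subset_rfl, fun x hx => ⟨fun _ _ h => h, fun _ => hpr x hx⟩⟩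

theorem prefix_concat_cases {x y : List A} {a : A} (h : x <+: y ++ [a]) :
    x = y ++ [a] ∨ x <+: y := List.prefix_concat_iff.1 h

theorem isPruned_auxTree (hT : IsTree T) (hpr : IsPruned T) (hK : K % 2 = 0) :
    IsPruned (auxTree T O K) := by
  rintro _ ⟨Q, V, y, rfl, hp⟩
  suffices ∃ Q' V' a, (K < y.length → Q = Q') ∧ (K + 1 < y.length → V = V') ∧
      Pos T O K Q' V' (y ++ [a]) by
    obtain ⟨Q', V', a, h1, h2, h3⟩ := this
    refine ⟨(a, lab K Q' V' y.length), Q', V', y ++ [a], ?_, h3⟩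
    rw [enc_concat, enc_congr h1 h2]
  obtain hl | hl | hl := lt_trichotomy y.length (K + 1)
  · obtain ⟨a, ha⟩ := hpr y hp.1
    refine ⟨T, ∅, a, fun _ => by omega, fun _ => by omega, ha, fun h => isQuasi_self hpr ?_,
      fun h => ?_⟩
    · exact hT (List.take_prefix _ _) ha
    · simp at h; omega
  · obtain ⟨a, ha⟩ := hpr y hp.1
    have hQ := hp.2.1 (by omega)
    rw [List.take_of_length_le hl.le] at hQ
    have hya : y ++ [a] ∈ Q := (hQ.2.2 y hQ.1).1 (by omega) a ha
    have hlen : (y ++ [a]).length = K + 2 := by simp [hl]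
    have key : ∃ V', (Escape T O Q V' (y ++ [a]) ∨ Stay O Q V' (y ++ [a])) ∧ y ++ [a] ∈ V' := by
      by_cases hu : ∃ u ∈ Q, y ++ [a] <+: u ∧ u ∈ O
      · obtain ⟨u, h1, h2, h3⟩ := hu
        exact ⟨_, .inl ⟨u, h1, h2, h3, rfl⟩, ha, .inl h2⟩
      · push Not at hu
        refine ⟨{z ∈ Q | y ++ [a] <+: z}, .inr ⟨⟨hya, List.prefix_refl _⟩, fun z hz => hz.1,
          fun z hz => hu z hz.1 hz.2, fun z hz => ⟨fun _ b hb => ⟨hb, ?_⟩, fun hz1 => ?_⟩⟩,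
          hya, List.prefix_refl _⟩
        · exact hz.2.trans (List.prefix_append _ _)
        · obtain ⟨b, hb⟩ := hpr z (hQ.2.1 hz.1)
          exact ⟨b, (hQ.2.2 z hz.1).1 hz1 b hb, hz.2.trans (List.prefix_append _ _)⟩
    obtain ⟨V', h1, h2⟩ := key
    refine ⟨Q, V', a, fun _ => rfl, fun _ => by omega, ha, fun h => ?_, fun h => ⟨?_, ?_⟩⟩
    · rwa [List.take_left' hl]
    · rwa [List.take_of_length_le hlen.le]
    · intro z hz hzl
      rwa [hz.eq_of_length (by have := hz.length_le; omega)]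
  · have hQ := hp.2.1 (by omega)
    obtain ⟨hQV, hV⟩ := hp.2.2 hl
    have hyV := hV y (List.prefix_refl _) hl
    suffices ∃ a, y ++ [a] ∈ T ∧ y ++ [a] ∈ V by
      obtain ⟨a, haT, haV⟩ := this
      refine ⟨Q, V, a, fun _ => rfl, fun _ => rfl, haT, fun _ => ?_, fun _ => ⟨?_, ?_⟩⟩
      · rwa [List.take_append_of_le_length (by omega)]
      · rwa [List.take_append_of_le_length (by omega)]
      · intro z hz hzl
        obtain rfl | hz := prefix_concat_cases hz
        · exact haV
        · exact hV z hz hzl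
    obtain ⟨u, hu, -, -, rfl⟩ | hS := hQV
    · obtain ⟨a, ha⟩ := exists_concat_mem_comparable hT hpr (hQ.2.1 hu) hyV
      exact ⟨a, ha.1, ha⟩
    · have : ∃ a, y ++ [a] ∈ V := by
        obtain h0 | h1 := Nat.mod_two_eq_zero_or_one y.length
        · obtain ⟨a, ha⟩ := (hQ.2.2 y (hS.2.1 hyV)).2 h0
          exact ⟨a, (hS.2.2.2 y hyV).1 h0 a ha⟩
        · exact (hS.2.2.2 y hyV).2 h1
      obtain ⟨a, ha⟩ := this
      exact ⟨a, hQ.2.1 (hS.2.1 ha), ha⟩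

theorem nonempty_auxTree (hT : IsTree T) (hne : T.Nonempty) : (auxTree T O K).Nonempty :=
  ⟨[], ∅, ∅, [], rfl, nil_mem hT hne, fun h => by simp at h, fun h => by simp at h⟩

end Aux

section Aux

variable {A : Type u} {T O : Set (List A)} {K i : ℕ} {Q V : Set (List A)} {a : ℕ → A}

theorem strategy_legal {σ : Strategy (auxTree T O K) i} {y : List A} (hp : Pos T O K Q V y)
    (hi : y.length % 2 = i % 2) :
    enc K Q V y ++ [σ.move (enc K Q V y)] ∈ auxTree T O K :=
  σ.legal _ (enc_mem_auxTree.2 hp) (by simpa using hi)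

theorem pos_of_le {y : List A} (hy : y ∈ T) (hl : y.length ≤ K) : Pos T O K Q V y :=
  ⟨hy, fun h => by omega, fun h => by omega⟩

theorem pos_res (ha : a ∈ body T) (hQ : IsQuasi T Q (res a (K + 1)))
    (hQV : Escape T O Q V (res a (K + 2)) ∨ Stay O Q V (res a (K + 2))) {n : ℕ}
    (hV : ∀ m, K + 2 ≤ m → m ≤ n → res a m ∈ V) : Pos T O K Q V (res a n) := by
  refine ⟨res_mem ha n, fun h => ?_, fun h => ⟨?_, fun z hz hzl => ?_⟩⟩
  · rw [length_res] at h
    rwa [take_res a h]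
  · rw [length_res] at h
    rwa [take_res a h]
  · have := hz.length_le
    rw [length_res] at this
    rw [eq_res_of_prefix hz]
    exact hV _ hzl this

theorem res_mem_comparable (ha : a ∈ body T) (n m : ℕ) : res a m ∈ comparable T (res a n) :=
  ⟨res_mem ha m, (le_total m n).imp (res_prefix a) (res_prefix a)⟩

theorem eq_of_concat_prefix {x : A} {n m : ℕ} (h : res a m ++ [x] <+: res a n) : x = a m := by
  have h1 := eq_res_of_prefix h
  simp only [List.length_append, length_res, List.length_cons, List.length_nil] at h1
  rw [zero_add, res_succ] at h1
  exact List.singleton_injective (List.append_inj' h1 rfl).2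

theorem exists_labels {e : ℕ → A × Set (List A)} (he : e ∈ body (auxTree T O K)) :
    ∃ Q V, ∀ n, K + 2 ≤ n → res e n = enc K Q V (res (fun m => (e m).1) n) ∧
      Pos T O K Q V (res (fun m => (e m).1) n) := by
  have key : ∀ n, ∃ Q V, res e n = enc K Q V (res (fun m => (e m).1) n) ∧
      Pos T O K Q V (res (fun m => (e m).1) n) := by
    intro n
    obtain ⟨Q, V, y, h, hp⟩ := res_mem he n
    obtain rfl : y = res (fun m => (e m).1) n := by
      rw [← map_res, h, map_fst_enc]
    exact ⟨Q, V, h, hp⟩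
  obtain ⟨Q, V, h, -⟩ := key (K + 2)
  refine ⟨Q, V, fun n hn => ?_⟩
  obtain ⟨Q', V', h', hp⟩ := key n
  have h2 := congrArg (List.take (K + 2)) h'
  rw [← enc_take, take_res _ hn, take_res _ hn, h] at h2
  obtain ⟨h3, h4⟩ := eq_of_enc_eq h2
  obtain rfl := h3 (by simp)
  obtain rfl := h4 (by simp)
  exact ⟨h', hp⟩

/-- `Q` witnesses that the second player, answering `r Q` to the quasi-strategy `Q` at `p`,
claims that `u ∈ O` will be reached. -/
def Claims (T O : Set (List A)) (p : List A) (r : Set (List A) → A × Set (List A)) (u : List A)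
    (Q : Set (List A)) : Prop :=
  IsQuasi T Q p ∧ u ∈ Q ∧ u ∈ O ∧ p ++ [(r Q).1] <+: u ∧ (r Q).2 = comparable T u

open Classical in
/-- A quasi-strategy witnessing `Claims`. -/
noncomputable def claimWitness (T O : Set (List A)) (p : List A)
    (r : Set (List A) → A × Set (List A)) (u : List A) : Set (List A) :=
  if h : ∃ Q, Claims T O p r u Q then h.choose else ∅

/-- The goal of the second player. -/
def claimSet (T O : Set (List A)) (p : List A) (r : Set (List A) → A × Set (List A)) :
    Set (List A) := {u | ∃ Q, Claims T O p r u Q}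

theorem claimWitness_spec {T O : Set (List A)} {p : List A} {r : Set (List A) → A × Set (List A)}
    {u : List A} (h : u ∈ claimSet T O p r) : Claims T O p r u (claimWitness T O p r u) := by
  have h' : ∃ Q, Claims T O p r u Q := h
  rw [claimWitness, dif_pos h']
  exact h'.choose_spec

/-- The positions from which the second player cannot force a claimed position. -/
def safeSet (T O : Set (List A)) (p : List A) (r : Set (List A) → A × Set (List A)) :
    Set (List A) := {z ∈ T | z ∉ Reach T (claimSet T O p r) 1}

end Aux

section OpenCovering

variable {A : Type u} [Inhabited A]

open Classical in
/-- The values of a move function on a set of positions, with default values elsewhere. -/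
noncomputable def guard {B : Type u} [Inhabited B] (S : Set (List B)) (f : List B → B)
    (x : List B) : B := if x ∈ S then f x else default

open Classical in
/-- The first player's moves in `T` derived from moves in the auxiliary game: `b` is the move at
level `K` and `q Q V` the move at the current position with labels `Q` and `V`. -/
noncomputable def candFst (O : Set (List A)) (K : ℕ) (b : A × Set (List A))
    (q : Set (List A) → Set (List A) → A × Set (List A)) (T : Set (List A)) (y : List A) : A :=
  if y.length ≤ K then (q ∅ ∅).1
  else if ∃ n, K + 2 ≤ n ∧ n ≤ y.length ∧ y.take n ∈ O then
    (q b.2 (comparable T (y.take (firstHit O (K + 2) y)))).1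
  else if y ∈ Reach b.2 O 0 then reachMove b.2 O 0 y
  else (q b.2 {z ∈ b.2 | z ∉ Reach b.2 O 0}).1

open Classical in
/-- The second player's moves in `T` derived from moves in the auxiliary game: `r Q` is the answer
to the quasi-strategy `Q` at level `K + 1` and `q Q V` the move at the current position with labels
`Q` and `V`. -/
noncomputable def candSnd (O : Set (List A)) (K : ℕ) (r : Set (List A) → A × Set (List A))
    (q : Set (List A) → Set (List A) → A × Set (List A)) (T : Set (List A)) (y : List A) : A :=
  if y.length ≤ K then (q ∅ ∅).1
  else if ∃ n, K + 2 ≤ n ∧ n ≤ y.length ∧ y.take n ∈ claimSet T O (y.take (K + 1)) r then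
    let u := y.take (firstHit (claimSet T O (y.take (K + 1)) r) (K + 2) y)
    (q (claimWitness T O (y.take (K + 1)) r u) (comparable T u)).1
  else if y ∈ Reach T (claimSet T O (y.take (K + 1)) r) 1 then
    reachMove T (claimSet T O (y.take (K + 1)) r) 1 y
  else (q (safeSet T O (y.take (K + 1)) r) (r (safeSet T O (y.take (K + 1)) r)).2).1

/-- Moves in `T` derived from moves `f` in the auxiliary game. -/
noncomputable def cand (T O : Set (List A)) (K i : ℕ)
    (f : List (A × Set (List A)) → A × Set (List A)) (y : List A) : A :=
  if i % 2 = 0 then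
    candFst O K (f (enc K ∅ ∅ (y.take K))) (fun Q V => f (enc K Q V y)) T y
  else
    candSnd O K (fun Q => f (enc K Q ∅ (y.take (K + 1)))) (fun Q V => f (enc K Q V y)) T y

theorem cand_congr {T O : Set (List A)} {K i n : ℕ}
    {f g : List (A × Set (List A)) → A × Set (List A)} (h : ∀ x, x.length ≤ n → f x = g x)
    {y : List A} (hy : y.length ≤ n) : cand T O K i f y = cand T O K i g y := by
  have h1 : f (enc K ∅ ∅ (y.take K)) = g (enc K ∅ ∅ (y.take K)) := h _ (by simp; omega)
  have h2 : (fun Q => f (enc K Q ∅ (y.take (K + 1)))) = fun Q => g (enc K Q ∅ (y.take (K + 1))) :=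
    funext fun Q => h _ (by simp; omega)
  have h3 : (fun Q V => f (enc K Q V y)) = fun Q V => g (enc K Q V y) :=
    funext fun Q => funext fun V => h _ (by simpa using hy)
  rw [cand, cand, h1, h2, h3]

theorem cand_of_le {T O : Set (List A)} {K i : ℕ}
    {f : List (A × Set (List A)) → A × Set (List A)} {y : List A} (hy : y.length ≤ K) :
    cand T O K i f y = (f (enc K ∅ ∅ y)).1 := by
  unfold cand candFst candSnd
  simp [hy]

variable {T O : Set (List A)} {K i : ℕ} {Q V : Set (List A)} {a : ℕ → A}

/-- The strategy in `T` induced by a strategy in the auxiliary game. -/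
noncomputable def auxStrategy (hpr : IsPruned T) (O : Set (List A)) (K i : ℕ)
    (σ : Strategy (auxTree T O K) i) : Strategy T i :=
  mkStrategy T hpr i (cand T O K i (guard (auxTree T O K) σ.move))

theorem guard_enc {f : List (A × Set (List A)) → A × Set (List A)} {y : List A}
    (h : Pos T O K Q V y) : guard (auxTree T O K) f (enc K Q V y) = f (enc K Q V y) :=
  if_pos (enc_mem_auxTree.2 h)

theorem auxStrategy_of_cand (hpr : IsPruned T) {σ : Strategy (auxTree T O K) i}
    {y : List A} (hp : Pos T O K Q V y) (hi : y.length % 2 = i % 2)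
    (hc : cand T O K i (guard (auxTree T O K) σ.move) y =
      (guard (auxTree T O K) σ.move (enc K Q V y)).1) :
    (auxStrategy hpr O K i σ).move y = (σ.move (enc K Q V y)).1 := by
  rw [guard_enc hp] at hc
  rw [auxStrategy, mkStrategy_move_of_mem hpr hi, hc]
  rw [hc]
  exact (legal_move (strategy_legal hp hi)).1

theorem move_of_cand {hpr : IsPruned T} {σ : Strategy (auxTree T O K) i}
    (ha : a ∈ plays (auxStrategy hpr O K i σ)) {n : ℕ} (hn : n % 2 = i % 2)
    (hp : Pos T O K Q V (res a n))
    (hc : cand T O K i (guard (auxTree T O K) σ.move) (res a n) =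
      (guard (auxTree T O K) σ.move (enc K Q V (res a n))).1) :
    a n = (σ.move (enc K Q V (res a n))).1 :=
  (ha.2 n hn).trans (auxStrategy_of_cand hpr hp (by simpa using hn) hc)

theorem move_of_le {hpr : IsPruned T} {σ : Strategy (auxTree T O K) i}
    (ha : a ∈ plays (auxStrategy hpr O K i σ)) {n : ℕ} (hn : n % 2 = i % 2) (hl : n ≤ K)
    (Q V : Set (List A)) : a n = (σ.move (enc K Q V (res a n))).1 := by
  refine move_of_cand ha hn (pos_of_le (res_mem ha.1 n) (by simpa using hl)) ?_
  rw [cand_of_le (by simpa using hl)]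
  rw [enc_congr (Q := Q) (V := V)] <;> intro h <;> simp at h <;> omega

theorem exists_lift (ha : a ∈ body T) (hQ : IsQuasi T Q (res a (K + 1)))
    (hQV : Escape T O Q V (res a (K + 2)) ∨ Stay O Q V (res a (K + 2)))
    (hV : ∀ m, K + 2 ≤ m → res a m ∈ V) {σ : Strategy (auxTree T O K) i}
    (hm : ∀ n, n % 2 = i % 2 → (σ.move (enc K Q V (res a n))).1 = a n ∧
      (n = K → (σ.move (enc K Q V (res a n))).2 = Q) ∧
      (n = K + 1 → (σ.move (enc K Q V (res a n))).2 = V)) :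
    ∃ a' ∈ plays σ, bodyMap (List.map Prod.fst) a' = a := by
  have hp : ∀ n, Pos T O K Q V (res a n) := fun n => pos_res ha hQ hQV fun m h _ => hV m h
  refine ⟨fun n => (a n, lab K Q V n), ⟨fun n => ?_, fun n hn => ?_⟩, ?_⟩
  · change res (fun n => (a n, lab K Q V n)) n ∈ _
    rw [← enc_res]
    exact enc_mem_auxTree.2 (hp n)
  · change (a n, lab K Q V n) = σ.move (res (fun n => (a n, lab K Q V n)) n)
    rw [← enc_res]
    obtain ⟨h1, h2, h3⟩ := hm n hn
    refine Prod.ext h1.symm ?_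
    by_cases h4 : n = K
    · rw [h2 h4, h4, lab_self]
    · by_cases h5 : n = K + 1
      · rw [h3 h5, h5, lab_succ]
      · have := (legal_move (strategy_legal (σ := σ) (hp n) (by simpa using hn))).2.2.2.1
          (by simpa using h4) (by simpa using h5)
        rw [this, lab_of_ne h4 h5]
  · rw [bodyMap_map]

/-- Lifting a play which meets the claimed position `res a n`. -/
theorem exists_lift_escape {hpr : IsPruned T} {σ : Strategy (auxTree T O K) i}
    (ha : a ∈ plays (auxStrategy hpr O K i σ)) {n : ℕ} (hn : K + 2 ≤ n)
    (hQ : IsQuasi T Q (res a (K + 1))) (hnQ : res a n ∈ Q) (hnO : res a n ∈ O)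
    (hK : K % 2 = i % 2 → (σ.move (enc K ∅ ∅ (res a K))).2 = Q)
    (hK1 : (K + 1) % 2 = i % 2 → (σ.move (enc K Q ∅ (res a (K + 1)))) =
      (a (K + 1), comparable T (res a n)))
    (hc : ∀ m, m % 2 = i % 2 → n ≤ m → cand T O K i (guard (auxTree T O K) σ.move) (res a m) =
      (guard (auxTree T O K) σ.move (enc K Q (comparable T (res a n)) (res a m))).1) :
    ∃ a' ∈ plays σ, bodyMap (List.map Prod.fst) a' = a := by
  have hE : Escape T O Q (comparable T (res a n)) (res a (K + 2)) :=
    ⟨res a n, hnQ, res_prefix a hn, hnO, rfl⟩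
  have hp : ∀ m, Pos T O K Q (comparable T (res a n)) (res a m) := fun m =>
    pos_res ha.1 hQ (.inl hE) fun m _ _ => res_mem_comparable ha.1 n m
  refine exists_lift ha.1 hQ (.inl hE) (fun m _ => res_mem_comparable ha.1 n m) fun m hm => ?_
  obtain h | rfl | h := lt_trichotomy m (K + 1)
  · refine ⟨(move_of_le ha hm (by omega) _ _).symm, ?_, by omega⟩
    rintro rfl
    rw [← hK hm, enc_congr] <;> intro h' <;> simp at h'
  · have : enc K Q (comparable T (res a n)) (res a (K + 1)) = enc K Q ∅ (res a (K + 1)) :=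
      enc_congr (fun _ => rfl) fun h => by simp at h
    rw [this, hK1 hm]
    exact ⟨rfl, by omega, fun _ => rfl⟩
  · refine ⟨?_, by omega, by omega⟩
    obtain hmn | hmn := le_or_gt n m
    · exact (move_of_cand ha hm (hp m) (hc m hm hmn)).symm
    · have := (legal_move (strategy_legal (σ := σ) (hp m) (by simpa using hm))).2.2.2.2
        (by simpa using h)
      obtain h1 | h1 := this.2
      · exact eq_of_concat_prefix h1
      · have h2 := h1.length_le
        simp only [List.length_append, length_res, List.length_cons, List.length_nil] at h2
        have h3 := h1.eq_of_length (by simp; omega)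
        exact eq_of_concat_prefix ⟨[], by rw [List.append_nil]; exact h3.symm⟩

theorem candFst_lift {hpr : IsPruned T} (hKe : K % 2 = 0) {σ : Strategy (auxTree T O K) i}
    (hi : i % 2 = 0) (ha : a ∈ plays (auxStrategy hpr O K i σ)) :
    ∃ a' ∈ plays σ, bodyMap (List.map Prod.fst) a' = a := by
  have hpK : ∀ Q V, Pos T O K Q V (res a K) := fun Q V =>
    pos_of_le (res_mem ha.1 K) (by simp)
  obtain ⟨b, hb⟩ : ∃ b, σ.move (enc K ∅ ∅ (res a K)) = b := ⟨_, rfl⟩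
  obtain ⟨Q, hQb⟩ : ∃ Q, b.2 = Q := ⟨_, rfl⟩
  obtain ⟨R, hR⟩ : ∃ R, Reach Q O 0 = R := ⟨_, rfl⟩
  have hOR : O ⊆ R := hR ▸ subset_reach
  have hQ : IsQuasi T Q (res a (K + 1)) := by
    have := (legal_move (strategy_legal (σ := σ) (hpK ∅ ∅) (by simp; omega))).2.1 (by simp)
    rwa [← move_of_le ha (by omega) le_rfl, ← res_succ, hb, hQb] at this
  have hcand : ∀ n, K + 2 ≤ n → cand T O K i (guard (auxTree T O K) σ.move) (res a n) =
      candFst O K b (fun Q V => guard (auxTree T O K) σ.move (enc K Q V (res a n))) T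
        (res a n) := by
    intro n hn
    rw [cand, if_pos hi, take_res a (by omega), guard_enc (hpK ∅ ∅), hb]
  have hstay : res a (K + 2) ∈ Q → res a (K + 2) ∉ R →
      Stay O Q {z ∈ Q | z ∉ R} (res a (K + 2)) := by
    intro h1 h2
    refine ⟨⟨h1, h2⟩, fun z hz => hz.1, fun z hz hzO => hz.2 (hOR hzO), fun z hz => ⟨?_, ?_⟩⟩
    · intro h0 x hx
      exact ⟨hx, hR ▸ not_reach_own (hR ▸ hz.2) h0 hx⟩
    · intro h0
      obtain ⟨x, hx, hx'⟩ := not_reach_opp (R := Q) (G := O) (j := 0) (hR ▸ hz.2) (by omega)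
      exact ⟨x, hx, hR ▸ hx'⟩
  -- while the play avoids `R`, it stays in `Q` and follows the auxiliary strategy
  have hnR : ∀ n, K + 2 ≤ n → (∀ m, K + 2 ≤ m → m ≤ n → res a m ∈ Q ∧ res a m ∉ R) →
      Pos T O K Q {z ∈ Q | z ∉ R} (res a n) ∧ (n % 2 = 0 →
        a n = (σ.move (enc K Q {z ∈ Q | z ∉ R} (res a n))).1) := by
    intro n hn h
    have hp : Pos T O K Q {z ∈ Q | z ∉ R} (res a n) :=
      pos_res ha.1 hQ (.inr (hstay (h _ le_rfl hn).1 (h _ le_rfl hn).2)) h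
    refine ⟨hp, fun hn2 => move_of_cand ha (by omega) hp ?_⟩
    rw [hcand n hn, candFst, if_neg (by simp; omega), if_neg, hQb, hR,
      if_neg (h n hn le_rfl).2]
    rintro ⟨m, h1, h2, h3⟩
    rw [length_res] at h2
    rw [take_res a h2] at h3
    exact (h m h1 h2).2 (hOR h3)
  have hodd : ∀ n, n % 2 = 1 → res a n ∈ Q → res a (n + 1) ∈ Q := by
    intro n hn h
    rw [res_succ]
    exact (hQ.2.2 _ h).1 (by simpa using hn) _ (by rw [← res_succ]; exact res_mem ha.1 _)
  have hinQ : ∀ n, K + 2 ≤ n → (∀ m, K + 2 ≤ m → m < n → res a m ∉ R) → res a n ∈ Q := by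
    intro n
    induction n using Nat.strong_induction_on with
    | _ n ih =>
      intro hn h
      obtain rfl | hn' := hn.eq_or_lt
      · exact hodd (K + 1) (by omega) hQ.1
      · obtain ⟨n, rfl⟩ : ∃ l, n = l + 1 := ⟨n - 1, by omega⟩
        have hall : ∀ m, K + 2 ≤ m → m ≤ n → res a m ∈ Q ∧ res a m ∉ R := fun m h1 h2 =>
          ⟨ih m (by omega) h1 fun m' h3 h4 => h m' h3 (by omega), h m h1 (by omega)⟩
        obtain h0 | h1 := Nat.mod_two_eq_zero_or_one n
        · obtain ⟨hp, hmv⟩ := hnR n (by omega) hall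
          have := (legal_move (strategy_legal (σ := σ) hp (by simp; omega))).2.2.2.2
            (by simp; omega)
          rw [← hmv h0, ← res_succ] at this
          exact this.1
        · exact hodd n h1 (hall n (by omega) le_rfl).1
  by_cases hex : ∃ n, K + 2 ≤ n ∧ res a n ∈ R
  · classical
    have hmin : ∀ m, K + 2 ≤ m → m < Nat.find hex → res a m ∉ R := fun m h1 h2 h3 =>
      Nat.find_min hex h2 ⟨h1, h3⟩
    obtain ⟨hn₀, hn₀R⟩ := Nat.find_spec hex
    generalize Nat.find hex = n₀ at hmin hn₀ hn₀R
    obtain ⟨n, hn, hnO, hnQ, hnmin⟩ := exists_hit (R := Q) (G := O) (j := 0) (hR ▸ hn₀R)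
      (hinQ n₀ hn₀ hmin) (by
        intro n hn hnQ hnR' hnO
        refine ⟨fun h0 => ?_, fun h0 => hodd n (by omega) hnQ⟩
        have hc : cand T O K i (guard (auxTree T O K) σ.move) (res a n) =
            reachMove Q O 0 (res a n) := by
          rw [hcand n (by omega), candFst, if_neg (by simp; omega), if_neg, hQb, if_pos hnR']
          rintro ⟨m, h1, h2, h3⟩
          rw [length_res] at h2
          rw [take_res a h2] at h3
          obtain h4 | h4 := le_or_gt n₀ m
          · exact hnO m h4 h2 h3
          · exact hmin m h1 h4 (hOR h3)
        refine (ha.2 n (by omega)).trans ?_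
        rw [← hc]
        refine mkStrategy_move_of_mem hpr (by simp; omega) ?_
        change res a n ++ [cand T O K i (guard (auxTree T O K) σ.move) (res a n)] ∈ T
        rw [hc]
        exact hQ.2.1 (reachMove_spec hnR' (hnO n hn le_rfl) (by simpa using h0)).1)
    have hnmin' : ∀ m, K + 2 ≤ m → m < n → res a m ∉ O := by
      intro m h1 h2
      obtain h4 | h4 := le_or_gt n₀ m
      · exact hnmin m h4 h2
      · exact fun h3 => hmin m h1 h4 (hOR h3)
    refine exists_lift_escape ha (hn₀.trans hn) hQ hnQ hnO (fun _ => by rw [hb, hQb])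
      (fun h => by omega) fun m hm hnm => ?_
    rw [hcand m (by omega), candFst, if_neg (by simp; omega), if_pos, hQb,
      firstHit_res (hn₀.trans hn) hnO hnmin' hnm, take_res a hnm]
    exact ⟨n, hn₀.trans hn, by simpa using hnm, by rwa [take_res a hnm]⟩
  · push Not at hex
    have hall : ∀ n, K + 2 ≤ n → res a n ∈ Q ∧ res a n ∉ R := fun n hn =>
      ⟨hinQ n hn fun m h1 _ => hex m h1, hex n hn⟩
    refine exists_lift ha.1 hQ (.inr (hstay (hall _ le_rfl).1 (hall _ le_rfl).2)) hall
      fun n hn => ?_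
    obtain h | h | h := lt_trichotomy n (K + 1)
    · refine ⟨(move_of_le ha hn (by omega) _ _).symm, ?_, by omega⟩
      rintro rfl
      rw [← hQb, ← hb, enc_congr] <;> intro h' <;> simp at h'
    · omega
    · exact ⟨((hnR n (by omega) fun m h1 _ => hall m h1).2 (by omega)).symm, by omega, by omega⟩

theorem candSnd_lift {hpr : IsPruned T} (hKe : K % 2 = 0) {σ : Strategy (auxTree T O K) i}
    (hi : i % 2 = 1) (ha : a ∈ plays (auxStrategy hpr O K i σ)) :
    ∃ a' ∈ plays σ, bodyMap (List.map Prod.fst) a' = a := by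
  obtain ⟨r, hr⟩ : ∃ r, (fun Q => guard (auxTree T O K) σ.move (enc K Q ∅ (res a (K + 1)))) = r :=
    ⟨_, rfl⟩
  obtain ⟨G, hG⟩ : ∃ G, claimSet T O (res a (K + 1)) r = G := ⟨_, rfl⟩
  have hpos : ∀ {Q V}, IsQuasi T Q (res a (K + 1)) → Pos T O K Q V (res a (K + 1)) := by
    intro Q V hQ
    refine ⟨res_mem ha.1 _, fun _ => ?_, fun h => by simp at h⟩
    rwa [take_res a le_rfl]
  have hrQ : ∀ {Q}, IsQuasi T Q (res a (K + 1)) → σ.move (enc K Q ∅ (res a (K + 1))) = r Q := by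
    intro Q hQ
    rw [← hr]
    exact (guard_enc (hpos hQ)).symm
  have hGlen : ∀ n, res a n ∈ G → K + 2 ≤ n := by
    intro n hn
    rw [← hG] at hn
    obtain ⟨Q, hQ⟩ := hn
    have := hQ.2.2.2.1.length_le
    simp only [List.length_append, length_res, List.length_cons, List.length_nil] at this
    omega
  have hGR : G ⊆ Reach T G 1 := subset_reach
  have hcand : ∀ n, K + 1 ≤ n → cand T O K i (guard (auxTree T O K) σ.move) (res a n) =
      candSnd O K r (fun Q V => guard (auxTree T O K) σ.move (enc K Q V (res a n))) T
        (res a n) := by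
    intro n hn
    rw [cand, if_neg (by omega), take_res a (by omega), hr]
  by_cases hex : ∃ n, K + 1 ≤ n ∧ res a n ∈ Reach T G 1
  · classical
    have hmin : ∀ m, K + 1 ≤ m → m < Nat.find hex → res a m ∉ Reach T G 1 := fun m h1 h2 h3 =>
      Nat.find_min hex h2 ⟨h1, h3⟩
    obtain ⟨hn₀, hn₀R⟩ := Nat.find_spec hex
    generalize Nat.find hex = n₀ at hmin hn₀ hn₀R
    obtain ⟨n, hn, hnG, -, hnmin⟩ := exists_hit hn₀R (res_mem ha.1 n₀) (by
        intro n hn _ hnR hnG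
        refine ⟨fun h1 => ?_, fun _ => res_mem ha.1 _⟩
        have hc : cand T O K i (guard (auxTree T O K) σ.move) (res a n) =
            reachMove T G 1 (res a n) := by
          rw [hcand n (by omega), candSnd, if_neg (by simp; omega), take_res a (by omega), hG,
            if_neg, if_pos hnR]
          rintro ⟨m, h1, h2, h3⟩
          rw [length_res] at h2
          rw [take_res a h2] at h3
          obtain h4 | h4 := le_or_gt n₀ m
          · exact hnG m h4 h2 h3
          · exact hmin m (by omega) h4 (hGR h3)
        refine (ha.2 n (by omega)).trans ?_
        rw [← hc]
        refine mkStrategy_move_of_mem hpr (by simp; omega) ?_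
        change res a n ++ [cand T O K i (guard (auxTree T O K) σ.move) (res a n)] ∈ T
        rw [hc]
        exact (reachMove_spec hnR (hnG n hn le_rfl) (by simpa using h1)).1)
    have hnmin' : ∀ m, K + 2 ≤ m → m < n → res a m ∉ G := by
      intro m h1 h2
      obtain h4 | h4 := le_or_gt n₀ m
      · exact hnmin m h4 h2
      · exact fun h3 => hmin m (by omega) h4 (hGR h3)
    have hKn := hGlen n hnG
    have hcl := claimWitness_spec (hG.symm ▸ hnG : res a n ∈ claimSet T O (res a (K + 1)) r)
    obtain ⟨hQ, hnQ, hnO, hpre, hr2⟩ := hcl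
    refine exists_lift_escape ha hKn hQ hnQ hnO (fun h => by omega) (fun _ => ?_)
      fun m hm hnm => ?_
    · rw [hrQ hQ]
      exact Prod.ext (eq_of_concat_prefix hpre) hr2
    · rw [hcand m (by omega), candSnd, if_neg (by simp; omega), take_res a (by omega), hG,
        if_pos, firstHit_res hKn hnG hnmin' hnm]
      · simp only [take_res a hnm]
      · exact ⟨n, hKn, by simpa using hnm, by rwa [take_res a hnm]⟩
  · push Not at hex
    obtain ⟨Q, hQdef⟩ : ∃ Q, safeSet T O (res a (K + 1)) r = Q := ⟨_, rfl⟩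
    have hQmem : ∀ z, z ∈ Q ↔ z ∈ T ∧ z ∉ Reach T G 1 := by
      intro z
      rw [← hQdef, safeSet, hG]
      rfl
    have hQ : IsQuasi T Q (res a (K + 1)) := by
      refine ⟨(hQmem _).2 ⟨res_mem ha.1 _, hex _ le_rfl⟩, fun z hz => ((hQmem z).1 hz).1,
        fun z hz => ⟨fun h1 x hx => ?_, fun h0 => ?_⟩⟩
      · exact (hQmem _).2 ⟨hx, not_reach_own ((hQmem z).1 hz).2 h1 hx⟩
      · obtain ⟨x, hx⟩ := not_reach_opp ((hQmem z).1 hz).2 (by omega)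
        exact ⟨x, (hQmem _).2 hx⟩
    have hc : ∀ n, K + 1 ≤ n → cand T O K i (guard (auxTree T O K) σ.move) (res a n) =
        (guard (auxTree T O K) σ.move (enc K Q (r Q).2 (res a n))).1 := by
      intro n hn
      rw [hcand n hn, candSnd, if_neg (by simp; omega), take_res a (by omega), hG,
        if_neg, if_neg (hex n hn), hQdef]
      rintro ⟨m, h1, h2, h3⟩
      rw [length_res] at h2
      rw [take_res a h2] at h3
      exact hex m (by omega) (hGR h3)
    have henc : ∀ V, enc K Q V (res a (K + 1)) = enc K Q ∅ (res a (K + 1)) := fun V =>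
      enc_congr (fun _ => rfl) fun h => by simp at h
    have hK1 : a (K + 1) = (r Q).1 := by
      rw [← hrQ hQ, ← henc (r Q).2]
      exact move_of_cand ha (by omega) (hpos hQ) (hc _ le_rfl)
    have hS : Stay O Q (r Q).2 (res a (K + 2)) := by
      have := (legal_move (strategy_legal (σ := σ) (hpos (V := ∅) hQ) (by simp; omega))).2.2.1
        (by simp)
      rw [hrQ hQ, ← hK1, ← res_succ] at this
      obtain ⟨u, hu, hpu, huO, huV⟩ | h := this
      · refine absurd (hGR ?_) ((hQmem u).1 hu).2
        rw [← hG]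
        refine ⟨Q, hQ, hu, huO, ?_, huV⟩
        rwa [← hK1, ← res_succ]
      · exact h
    have hV : ∀ n, K + 2 ≤ n → res a n ∈ (r Q).2 := by
      intro n
      induction n using Nat.strong_induction_on with
      | _ n ih =>
        intro hn
        obtain rfl | hn' := hn.eq_or_lt
        · exact hS.1
        · obtain ⟨n, rfl⟩ : ∃ l, n = l + 1 := ⟨n - 1, by omega⟩
          have hin := ih n (by omega) (by omega)
          obtain h0 | h1 := Nat.mod_two_eq_zero_or_one n
          · rw [res_succ]
            refine (hS.2.2.2 _ hin).1 (by simpa using h0) _ ?_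
            rw [← res_succ]
            exact (hQmem _).2 ⟨res_mem ha.1 _, hex _ (by omega)⟩
          · have hp : Pos T O K Q (r Q).2 (res a n) :=
              pos_res ha.1 hQ (.inr hS) fun m h1 h2 => ih m (by omega) h1
            have := (legal_move (strategy_legal (σ := σ) hp (by simp; omega))).2.2.2.2
              (by simp; omega)
            rwa [← move_of_cand ha (by omega) hp (hc n (by omega)), ← res_succ] at this
    refine exists_lift ha.1 hQ (.inr hS) hV fun n hn => ?_
    obtain h | rfl | h := lt_trichotomy n (K + 1)
    · exact ⟨(move_of_le ha hn (by omega) _ _).symm, by omega, by omega⟩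
    · rw [henc, hrQ hQ]
      exact ⟨hK1.symm, by omega, fun _ => rfl⟩
    · refine ⟨(move_of_cand ha hn ?_ (hc n (by omega))).symm, by omega, by omega⟩
      exact pos_res ha.1 hQ (.inr hS) fun m h1 _ => hV m h1

/-- The covering of `T` by the auxiliary game. -/
noncomputable def auxCovering (hpr : IsPruned T) (O : Set (List A)) (hKe : K % 2 = 0) :
    Covering (auxTree T O K) T where
  π :=
    { toFun := List.map Prod.fst
      mem := by
        rintro _ ⟨Q, V, y, rfl, hp⟩
        rw [map_fst_enc]
        exact hp.1
      len := fun x _ => by simp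
      mono := fun x y _ _ h => h.map _ }
  φ i σ := auxStrategy hpr O K i σ
  agree i n σ σ' h y _ hl := by
    refine mkStrategy_move_congr hpr fun _ => cand_congr (fun x hx => ?_) hl
    unfold guard
    split_ifs with hxS
    · exact h x hxS hx
    · rfl
  lift i σ a ha := by
    obtain h | h := Nat.mod_two_eq_zero_or_one i
    · exact candFst_lift hKe h ha
    · exact candSnd_lift hKe h ha

theorem isFixing_auxCovering (hpr : IsPruned T) (hKe : K % 2 = 0) :
    IsFixing K (auxCovering hpr O hKe) := by
  refine .intro ?_ (fun y hy hl => ⟨_, ⟨∅, ∅, y, rfl, pos_of_le hy hl⟩, map_fst_enc y⟩) ?_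
  · rintro _ ⟨Q, V, y, rfl, hp⟩ _ ⟨Q', V', y', rfl, hp'⟩ hl h
    change List.map Prod.fst _ = List.map Prod.fst _ at h
    rw [map_fst_enc, map_fst_enc] at h
    subst h
    rw [length_enc] at hl
    exact enc_congr (fun h => by omega) fun h => by omega
  · rintro i σ _ ⟨Q, V, y, rfl, hp⟩ hl hi
    rw [length_enc] at hl hi
    change List.map Prod.fst _ = List.map Prod.fst _ ++
      [(auxStrategy hpr O K i σ).move (List.map Prod.fst _)]
    rw [List.map_append, map_fst_enc, auxStrategy_of_cand hpr hp hi]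
    · rfl
    · rw [cand_of_le hl.le, enc_congr (Q := Q) (V := V)] <;> intro h <;> omega

/-- Open sets are unravelable. -/
theorem unravelable_of_isOpen {P : Set (ℕ → A)} (hT : IsTree T) (hpr : IsPruned T)
    (hne : T.Nonempty) (hP : @IsOpen _ (bodyTop T) {a : {a // a ∈ body T} | a.1 ∈ P}) :
    Unravelable T P := by
  intro k
  let O : Set (List A) := {u | ∀ a ∈ body T, res a u.length = u → a ∈ P}
  have hKe : 2 * k % 2 = 0 := by omega
  refine ⟨A × Set (List A), auxTree T O (2 * k), auxCovering hpr O hKe, isTree_auxTree hT,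
    isPruned_auxTree hT hpr hKe, nonempty_auxTree hT hne,
    (isFixing_auxCovering hpr hKe).mono (by omega), ?_⟩
  refine isClopen_of_res (2 * k + 2) fun e e' he h => ?_
  obtain ⟨Q, V, hQV⟩ := exists_labels e.2
  obtain ⟨Q', V', hQV'⟩ := exists_labels e'.2
  have haT := (auxCovering hpr O hKe).π.bodyMap_mem e.2
  have haT' := (auxCovering hpr O hKe).π.bodyMap_mem e'.2
  change bodyMap (List.map Prod.fst) e.1 ∈ P at h
  change bodyMap (List.map Prod.fst) e'.1 ∈ P
  change bodyMap (List.map Prod.fst) e.1 ∈ body T at haT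
  change bodyMap (List.map Prod.fst) e'.1 ∈ body T at haT'
  rw [bodyMap_map] at h haT haT' ⊢
  have hres := congrArg (List.map Prod.fst) he
  rw [map_res, map_res] at hres
  have h2 := he
  rw [(hQV _ le_rfl).1, (hQV' _ le_rfl).1, hres] at h2
  obtain ⟨h3, h4⟩ := eq_of_enc_eq h2
  obtain rfl := h3 (by simp)
  obtain rfl := h4 (by simp)
  obtain ⟨n, hn⟩ := exists_res_of_isOpen hP (a := ⟨_, haT⟩) h
  obtain ⟨u, -, hpu, huO, rfl⟩ | hS := ((hQV _ le_rfl).2.2.2 (by simp)).1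
  · refine huO _ haT' ?_
    rw [take_res _ le_rfl] at hpu
    have h5 := hpu.length_le
    rw [length_res] at h5
    have h6 := ((hQV' (u.length + 2 * k + 2) (by omega)).2.2.2 (by rw [length_res]; omega)).2 _
      (res_prefix _ (by omega : u.length ≤ _)) (by rw [length_res]; omega)
    obtain h7 | h7 := h6.2
    · exact h7.eq_of_length (by simp)
    · exact (h7.eq_of_length (by simp)).symm
  · refine absurd ?_ (hS.2.2.1 (res (fun m => (e.1 m).1) (n + 2 * k + 2)) ?_)
    · intro b hb hbr
      rw [length_res] at hbr
      refine hn ⟨b, hb⟩ ?_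
      have := congrArg (List.take n) hbr
      rwa [take_res _ (by omega), take_res _ (by omega)] at this
    · exact ((hQV (n + 2 * k + 2) (by omega)).2.2.2 (by rw [length_res]; omega)).2 _
        (List.prefix_refl _) (by rw [length_res]; omega)

end OpenCovering

/-- A nonempty pruned tree covering `T`. -/
structure Stage {A : Type u} [Inhabited A] (T : Set (List A)) where
  B : Type u
  inh : Inhabited B
  S : Set (List B)
  cov : Covering S T
  tree : IsTree S
  pruned : IsPruned S
  nonempty : S.Nonempty

attribute [instance] Stage.inh

section Union

variable {A : Type u} [Inhabited A] {T : Set (List A)} {P : ℕ → Set (ℕ → A)}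

theorem nonempty_of_isPruned {B : Type u} {S : Set (List B)} (hS : IsPruned S)
    (hne : S.Nonempty) : Nonempty B :=
  let ⟨x, hx⟩ := hne
  ⟨(hS x hx).choose⟩

/-- `s'` is a `k`-fixing refinement of the stage `s` which unravels the preimage of `D`. -/
structure Refines (D : Set (ℕ → A)) (k : ℕ) (s' s : Stage T) (c : Covering s'.S s.S) : Prop where
  fixing : IsFixing k c
  clopen : @IsClopen _ (bodyTop s'.S) {a : {a // a ∈ body s'.S} | bodyMap s'.cov.π.toFun a.1 ∈ D}
  comm : ∀ a ∈ body s'.S,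
    bodyMap s'.cov.π.toFun a = bodyMap s.cov.π.toFun (bodyMap c.π.toFun a)

theorem exists_refines {D : Set (ℕ → A)} (h : UnivUnravelable T D) (k : ℕ) (s : Stage T) :
    ∃ s' c, Refines D k s' s c := by
  obtain ⟨B, S, c, h1, h2, h3, h4, h5⟩ :=
    h s.B s.inh s.S s.cov s.tree s.pruned s.nonempty k
  have : Inhabited B := ⟨(nonempty_of_isPruned h2 h3).some⟩
  refine ⟨⟨B, this, S, s.cov.comp c, h1, h2, h3⟩, c, h4, ?_,
    fun a ha => s.cov.π.bodyMap_comp c.π ha⟩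
  convert h5 using 2
  ext a
  change bodyMap (s.cov.π.comp c.π).toFun a.1 ∈ D ↔ _
  rw [s.cov.π.bodyMap_comp c.π a.2]
  rfl

theorem unravelable_iUnion (hT : IsTree T) (hpr : IsPruned T) (hne : T.Nonempty)
    (h : ∀ i, UnivUnravelable T (P i)) : Unravelable T (⋃ i, P i) := by
  intro k
  obtain ⟨st, h0, hst⟩ := exists_thread (X := fun _ => Stage T)
    (fun n s' s => ∃ c, Refines (P n) (k + n) s' s c) 0
    (fun m _ s => exists_refines (h m) (k + m) s) (fun m hm => absurd hm (Nat.not_lt_zero m))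
    ⟨A, inferInstance, T, .id T, hT, hpr, hne⟩
  choose c hc using hst
  let L := limTree (S := fun n => (st n).S) c
  have hfix : IsFixing k (st 0).cov := by
    rw [h0]
    exact IsFixing.id T k
  have hf : ∀ n, IsFixing (k + n) (c n) := fun n => (hc n).fixing
  have htree : IsTree L := isTree_limTree fun n => (st n).tree
  have hpruned : IsPruned L :=
    isPruned_limTree (fun n => (st n).pruned) (fun n => (st n).tree) hf
  have hnonempty : L.Nonempty :=
    nonempty_limTree (fun n => (st n).tree) fun n => (st n).nonempty
  let d : Covering L (st 0).S := limCovering c (fun n => (st n).pruned) hf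
  let C := (st 0).cov.comp d
  have hC : IsFixing k C := hfix.comp (isFixing_limCovering _ hf)
  have hproj : ∀ a ∈ body L, ∀ n,
      bodyMap C.π.toFun a = bodyMap (st n).cov.π.toFun (fun m => a m n) := by
    intro a ha n
    induction n with
    | zero =>
      refine ((st 0).cov.π.bodyMap_comp d.π ha).trans ?_
      exact congrArg _ (bodyMap_map (fun b : ∀ n, (st n).B => b 0) a)
    | succ n ih => rw [ih, (hc n).comm _ (body_limTree ha (n + 1)), bodyMap_limTree ha n]
  have hopen : @IsOpen _ (bodyTop L)
      {a : {a // a ∈ body L} | a.1 ∈ bodyMap C.π.toFun ⁻¹' ⋃ i, P i} := by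
    refine isOpen_of_res fun a ha => ?_
    obtain ⟨n, hn⟩ := Set.mem_iUnion.1 (Set.mem_preimage.1 ha)
    rw [hproj a.1 a.2 (n + 1)] at hn
    obtain ⟨l, hl⟩ := exists_res_of_isOpen (hc n).clopen.2
      (a := ⟨_, body_limTree a.2 (n + 1)⟩) hn
    refine ⟨l, fun b hb => Set.mem_iUnion.2 ⟨n, ?_⟩⟩
    rw [hproj b.1 b.2 (n + 1)]
    refine hl ⟨_, body_limTree b.2 (n + 1)⟩ ?_
    have := congrArg (List.map fun x : ∀ n, (st n).B => x (n + 1)) hb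
    rwa [map_res, map_res] at this
  obtain ⟨B, S, e, h1, h2, h3, h4, h5⟩ := unravelable_of_isOpen htree hpruned hnonempty hopen k
  refine ⟨B, S, C.comp e, h1, h2, h3, hC.comp h4, ?_⟩
  convert h5 using 2
  ext a
  change bodyMap (C.π.comp e.π).toFun a.1 ∈ _ ↔ _
  rw [C.π.bodyMap_comp e.π a.2]
  rfl

theorem UnivUnravelable.preimage {B : Type u} [Inhabited B] {S : Set (List B)} {D : Set (ℕ → A)}
    (h : UnivUnravelable T D) (c : Covering S T) :
    UnivUnravelable S (bodyMap c.π.toFun ⁻¹' D) := by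
  intro B' _ S' d h1 h2 h3
  refine (h B' _ S' (c.comp d) h1 h2 h3).congr fun a ha => ?_
  change bodyMap (c.π.comp d.π).toFun a ∈ D ↔ _
  rw [c.π.bodyMap_comp d.π ha]
  rfl

end Union

/-- Countable unions of universally unravelable sets are unravelable (indeed universally
unravelable). -/
theorem univUnravelable_iUnion {A : Type u} [Inhabited A] (T : Set (List A))
    (hT : IsTree T) (hpr : IsPruned T) (hne : T.Nonempty)
    (P : ℕ → Set (ℕ → A)) (h : ∀ i, UnivUnravelable T (P i)) :
    Unravelable T (⋃ i, P i) ∧ UnivUnravelable T (⋃ i, P i) := by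
  refine ⟨unravelable_iUnion hT hpr hne h, fun B _ S c h1 h2 h3 => ?_⟩
  rw [Set.preimage_iUnion]
  exact unravelable_iUnion h1 h2 h3 fun i => (h i).preimage c

end GS
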